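/- arXiv:0710.0862 — 2 statements merged into one kernel-verified Lean document; each statement's English description precedes it below -/
import Mathlib

section
/- Let n ≥ 1, α ≥ 2, m = αn, and let (C,B,A) be an m×(n,m,m) triple. For every ε > 0 there exist an m×(n,m,m) triple Δ with ‖Δ‖ < ε, pairwise distinct complex numbers λ_1,…,λ_n, and matrices N_{ij} ∈ ℂ^{n×n} for 1 ≤ i ≤ α−1 and 1 ≤ j ≤ α, such that: N_{11} = diag(λ_1,…,λ_n); the entries of N_{12} in positions (1,2),…,(1,n) all equal 1; and (C,B,A) + Δ is feedback similar to the triple whose C-component is the αn×n block column [I_n; 0; …; 0], whose B-component is the αn×αn block matrix with I_n blocks on the first block subdiagonal and zero blocks elsewhere, and whose A-component is [0_{n,αn}; N], where N is the (α−1)n×αn block matrix N = [N_{ij}]. -/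
open Matrix

/-- An `m×(n,m)` pair: a pair `(B, A)` with `B ∈ ℂ^{m×n}` and `A ∈ ℂ^{m×m}`. -/
abbrev PairT (m n : ℕ) :=
  Matrix (Fin m) (Fin n) ℂ × Matrix (Fin m) (Fin m) ℂ

/-- Feedback similarity of `m×(n,m)` pairs: `(B,A)` and `(B',A')` are feedback similar if
`B' = S⁻¹BP` and `A' = S⁻¹(AS + BU)` for some invertible `S, P` and some `U`. -/
def FSP {m n : ℕ} (X Y : PairT m n) : Prop :=
  ∃ (S : Matrix (Fin m) (Fin m) ℂ) (P : Matrix (Fin n) (Fin n) ℂ)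
    (U : Matrix (Fin n) (Fin m) ℂ),
    IsUnit S ∧ IsUnit P ∧ Y.1 = S⁻¹ * X.1 * P ∧ Y.2 = S⁻¹ * (X.2 * S + X.1 * U)

/-- An `m×(n,m,m)` triple: a triple `(C, B, A)` with `C ∈ ℂ^{m×n}` and `B, A ∈ ℂ^{m×m}`. -/
abbrev TripleT (m n : ℕ) :=
  Matrix (Fin m) (Fin n) ℂ × Matrix (Fin m) (Fin m) ℂ × Matrix (Fin m) (Fin m) ℂ

/-- Feedback similarity of `m×(n,m,m)` triples: `(C,B,A)` and `(C',B',A')` are feedback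
similar if `C' = S⁻¹CP`, `B' = S⁻¹(BS + CV)`, `A' = S⁻¹(AS + CU)` for some invertible
`S, P` and some `U, V`. -/
def FST {m n : ℕ} (X Y : TripleT m n) : Prop :=
  ∃ (S : Matrix (Fin m) (Fin m) ℂ) (P : Matrix (Fin n) (Fin n) ℂ)
    (U V : Matrix (Fin n) (Fin m) ℂ),
    IsUnit S ∧ IsUnit P ∧ Y.1 = S⁻¹ * X.1 * P ∧
    Y.2.1 = S⁻¹ * (X.2.1 * S + X.1 * V) ∧ Y.2.2 = S⁻¹ * (X.2.2 * S + X.1 * U)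

/-- Frobenius norm of a complex matrix. -/
noncomputable def fnorm {p q : ℕ} (M : Matrix (Fin p) (Fin q) ℂ) : ℝ :=
  Real.sqrt (∑ i, ∑ j, ‖M i j‖ ^ 2)

/-- Norm of a pair: `‖(B,A)‖ = ‖B‖ + ‖A‖`. -/
noncomputable def pnorm {m n : ℕ} (X : PairT m n) : ℝ := fnorm X.1 + fnorm X.2

/-- Norm of a triple: `‖(C,B,A)‖ = ‖C‖ + ‖B‖ + ‖A‖`. -/
noncomputable def tnorm {m n : ℕ} (X : TripleT m n) : ℝ :=
  fnorm X.1 + fnorm X.2.1 + fnorm X.2.2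

/-- The `αn×n` block column `[I_n; 0; …; 0]`. -/
def bigC (α n : ℕ) : Matrix (Fin (α * n)) (Fin n) ℂ := fun i j =>
  if (i:ℕ) = (j:ℕ) then 1 else 0

/-- The `αn×αn` block matrix with `I_n` on the first block subdiagonal: entry 1 iff
`i = j + n`. -/
def bigB (α n : ℕ) : Matrix (Fin (α * n)) (Fin (α * n)) ℂ := fun i j =>
  if (i:ℕ) = (j:ℕ) + n then 1 else 0

/-- The `αn×αn` matrix `[0_{n,αn}; N]` where `N = [N_{ij}]` is the `(α-1)n×αn` block
matrix with `n×n` blocks `N i j`. -/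
def bigA (α n : ℕ) (hn : 1 ≤ n) (hα : 2 ≤ α)
    (N : Fin (α - 1) → Fin α → Matrix (Fin n) (Fin n) ℂ) :
    Matrix (Fin (α * n)) (Fin (α * n)) ℂ := fun i j =>
  if h : (i:ℕ) < n then 0
  else
    N ⟨((i:ℕ) - n) / n, by
        apply Nat.div_lt_of_lt_mul
        have ec : n * (α - 1) = (α - 1) * n := Nat.mul_comm n (α - 1)
        have hi := i.isLt
        have e1 : (α - 1) * n + n = α * n := by
          obtain ⟨a, rfl⟩ : ∃ a, α = a + 2 := ⟨α - 2, by omega⟩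
          have e2 : (a + 2 - 1) * n = a * n + n := by
            rw [show a + 2 - 1 = a + 1 from rfl]; ring
          have e3 : (a + 2) * n = a * n + n + n := by ring
          omega
        omega⟩
      ⟨(j:ℕ) / n, Nat.div_lt_of_lt_mul (by have ec : n * α = α * n := Nat.mul_comm n α; have := j.isLt; omega)⟩
      ⟨((i:ℕ) - n) % n, Nat.mod_lt _ (by omega)⟩
      ⟨(j:ℕ) % n, Nat.mod_lt _ (by omega)⟩


/-- A nonzero polynomial is nonzero near any point. -/
lemma dense_poly (p : Polynomial ℂ) (hp : p.eval 1 ≠ 0) :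
    Dense {t : ℂ | p.eval t ≠ 0} := by
  have h0 : p ≠ 0 := by rintro rfl; simp at hp
  have hfin : {t : ℂ | p.eval t = 0}.Finite := by
    have := p.rootSet_finite ℂ
    refine this.subset ?_
    intro t ht
    rw [Polynomial.mem_rootSet]
    exact ⟨h0, by simpa using ht⟩
  exact hfin.countable.dense_compl ℂ

lemma mem_closure_path {X : Type*} [TopologicalSpace X] (f : ℂ → X) (hf : Continuous f)
    (G : Set X) (D : Set ℂ) (hD : Dense D) (h : ∀ t ∈ D, f t ∈ G) : f 0 ∈ closure G := by
  have : Set.MapsTo f (closure D) (closure G) := by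
    apply Set.MapsTo.closure _ hf
    exact h
  exact this (hD 0)

lemma diag_of_coprime {n : ℕ} (M : Matrix (Fin n) (Fin n) ℂ)
    (h : IsCoprime M.charpoly M.charpoly.derivative) :
    ∃ (lam : Fin n → ℂ) (Q : Matrix (Fin n) (Fin n) ℂ), Function.Injective lam ∧
      IsUnit Q ∧ M * Q = Q * Matrix.diagonal lam := by
  have hsep : M.charpoly.Separable := h
  have hcard : Fintype.card (M.charpoly.rootSet ℂ) = n := by
    rw [Polynomial.card_rootSet_eq_natDegree hsep (IsAlgClosed.splits _)]
    simp
  let e : Fin n ≃ M.charpoly.rootSet ℂ := (Fintype.equivFinOfCardEq hcard).symm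
  let lam : Fin n → ℂ := fun i => (e i : ℂ)
  have hinj : Function.Injective lam := Subtype.coe_injective.comp e.injective
  have hev : ∀ i, ∃ v, Module.End.HasEigenvector (Matrix.toLin' M) (lam i) v := by
    intro i
    apply Module.End.HasEigenvalue.exists_hasEigenvector
    rw [Module.End.hasEigenvalue_iff_isRoot_charpoly]
    have := (e i).2
    rw [Polynomial.mem_rootSet] at this
    simpa [Polynomial.IsRoot] using this.2
  choose v hv using hev
  have hli := Module.End.eigenvectors_linearIndependent' (Matrix.toLin' M) lam hinj v hv
  refine ⟨lam, Matrix.of (fun i j => v j i), hinj, ?_, ?_⟩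
  · rw [← Matrix.isUnit_transpose]
    rw [← Matrix.linearIndependent_rows_iff_isUnit]
    exact hli
  · ext i j
    have h1 := (hv j).apply_eq_smul
    have h2 := congrFun h1 i
    simp only [Matrix.toLin'_apply, Matrix.mulVec, dotProduct, Pi.smul_apply, smul_eq_mul] at h2
    rw [Matrix.mul_diagonal, Matrix.mul_apply]
    simp only [Matrix.of_apply]
    rw [h2, mul_comm]

lemma dense_diag {n : ℕ} (M : Matrix (Fin n) (Fin n) ℂ) :
    M ∈ closure {M | ∃ (lam : Fin n → ℂ) (Q : Matrix (Fin n) (Fin n) ℂ), Function.Injective lam ∧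
      IsUnit Q ∧ M * Q = Q * Matrix.diagonal lam} := by
  let D : Matrix (Fin n) (Fin n) ℂ := Matrix.diagonal (fun i => ((i:ℕ) : ℂ))
  let L : Matrix (Fin n) (Fin n) (Polynomial ℂ) :=
    M.map Polynomial.C + (Polynomial.X : Polynomial ℂ) • (D - M).map Polynomial.C
  let p : Polynomial ℂ := Polynomial.resultant L.charpoly L.charpoly.derivative n (n-1)
  have hL : ∀ t : ℂ, L.map (Polynomial.evalRingHom t) = M + t • (D - M) := by
    intro t
    ext i j
    simp [L]
  have hp : ∀ t : ℂ, p.eval t ≠ 0 ↔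
      IsCoprime (M + t • (D - M)).charpoly (M + t • (D - M)).charpoly.derivative := by
    intro t
    have h1 : p.eval t = Polynomial.resultant (M + t • (D - M)).charpoly
        (M + t • (D - M)).charpoly.derivative n (n-1) := by
      rw [← Polynomial.coe_evalRingHom, ← Polynomial.resultant_map_map, ← hL, Matrix.charpoly_map,
        Polynomial.derivative_map]
    have h2 : (M + t • (D - M)).charpoly.natDegree = n := by simp
    have h3 : (M + t • (D - M)).charpoly.derivative.natDegree = n - 1 := by
      rw [Polynomial.natDegree_derivative, h2]
    have h4 := Polynomial.resultant_eq_zero_iff (f := (M + t • (D - M)).charpoly)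
      (g := (M + t • (D - M)).charpoly.derivative)
    rw [h2, h3] at h4
    rw [h1, Ne, h4]
    have := (Matrix.charpoly_monic (M + t • (D - M))).ne_zero
    tauto
  have h1 : p.eval 1 ≠ 0 := by
    rw [hp]
    have : M + (1:ℂ) • (D - M) = D := by simp
    rw [this]
    change (D.charpoly).Separable
    rw [Matrix.charpoly_diagonal]
    apply Polynomial.separable_prod_X_sub_C_iff.2
    intro i j hij
    apply Fin.ext
    simpa using hij
  have := mem_closure_path (fun t : ℂ => M + t • (D - M)) (by fun_prop)
    {M | ∃ (lam : Fin n → ℂ) (Q : Matrix (Fin n) (Fin n) ℂ), Function.Injective lam ∧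
      IsUnit Q ∧ M * Q = Q * Matrix.diagonal lam} _ (dense_poly p h1)
    (fun t ht => diag_of_coprime _ ((hp t).1 ht))
  simpa using this

/-- The index of column `b` in block `k`. -/
def ixx {α n : ℕ} (k : ℕ) (hk : k < α) (b : Fin n) : Fin (α * n) :=
  ⟨b + k * n, by
    have := b.isLt
    have h2 : (k + 1) * n ≤ α * n := Nat.mul_le_mul_right n hk
    have h3 : (k + 1) * n = k * n + n := by ring
    omega⟩

/-- The block column with identity in block `k`. -/
def blkE (α n k : ℕ) : Matrix (Fin (α * n)) (Fin n) ℂ := fun i j =>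
  if (i : ℕ) = (j : ℕ) + k * n then 1 else 0

/-- Concatenation of blocks. -/
def catM {R : Type*} {p α n : ℕ} (F : ℕ → Matrix (Fin p) (Fin n) R) :
    Matrix (Fin p) (Fin (α * n)) R := fun i j => F (j.divNat : ℕ) i j.modNat

lemma ixx_surj {α n : ℕ} (j : Fin (α * n)) :
    ∃ (k : ℕ) (hk : k < α) (b : Fin n), j = ixx k hk b := by
  refine ⟨j.divNat, j.divNat.isLt, j.modNat, ?_⟩
  apply Fin.ext
  simp only [ixx, Fin.coe_divNat, Fin.coe_modNat]
  have := Nat.mod_add_div (j : ℕ) n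
  have h2 : n * ((j : ℕ) / n) = (j : ℕ) / n * n := mul_comm _ _
  omega

lemma ixx_div {n : ℕ} (k : ℕ) (b : Fin n) :
    ((b : ℕ) + k * n) / n = k := by
  have hb := b.isLt
  rw [Nat.add_mul_div_right _ _ (by omega), Nat.div_eq_of_lt hb]; simp

lemma ixx_mod {n : ℕ} (k : ℕ) (b : Fin n) :
    ((b : ℕ) + k * n) % n = b := by
  simp [Nat.mod_eq_of_lt]

lemma ixx_inj {n : ℕ} (k l : ℕ) (b c : Fin n) (h : (b : ℕ) + k * n = c + l * n) :
    k = l ∧ b = c := by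
  have h1 := ixx_div k b
  have h2 := ixx_div l c
  have h3 := ixx_mod k b
  have h4 := ixx_mod l c
  rw [h] at h1 h3
  exact ⟨h1.symm.trans h2, Fin.ext (h3.symm.trans h4)⟩

lemma mul_blkE {p α n : ℕ} (M : Matrix (Fin p) (Fin (α * n)) ℂ) (k : ℕ) (hk : k < α)
    (i : Fin p) (b : Fin n) : (M * blkE α n k) i b = M i (ixx k hk b) := by
  rw [Matrix.mul_apply, Finset.sum_eq_single (ixx k hk b)]
  · simp [blkE, ixx]
  · intro j _ hj
    have : ¬ ((j : ℕ) = b + k * n) := fun h => hj (Fin.ext h)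
    simp [blkE, this]
  · simp

lemma blkE_ext {p α n : ℕ} (M M' : Matrix (Fin p) (Fin (α * n)) ℂ)
    (h : ∀ k < α, M * blkE α n k = M' * blkE α n k) : M = M' := by
  ext i j
  obtain ⟨k, hk, b, rfl⟩ := ixx_surj j
  rw [← mul_blkE M k hk, ← mul_blkE M' k hk, h k hk]

lemma catM_mul {p α n : ℕ} (F : ℕ → Matrix (Fin p) (Fin n) ℂ) (k : ℕ) (hk : k < α) :
    (catM F : Matrix (Fin p) (Fin (α * n)) ℂ) * blkE α n k = F k := by
  ext i b
  rw [mul_blkE _ _ hk]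
  have h1 : ((ixx k hk b).divNat : ℕ) = k := by
    rw [Fin.coe_divNat]; exact ixx_div k b
  have h2 : (ixx k hk b).modNat = b := by
    apply Fin.ext; rw [Fin.coe_modNat]; exact ixx_mod k b
  simp only [catM, h1, h2]

lemma bigC_eq (α n : ℕ) : bigC α n = blkE α n 0 := by
  ext i j; simp [bigC, blkE]

lemma bigB_mul (α n k : ℕ) (hk : k < α) : bigB α n * blkE α n k = blkE α n (k + 1) := by
  ext i b
  rw [mul_blkE _ _ hk]
  have : (b : ℕ) + k * n + n = b + (k + 1) * n := by ring
  change (if (i : ℕ) = (b : ℕ) + k * n + n then (1 : ℂ) else 0) = _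
  rw [this]
  rfl

lemma blkE_last (α n : ℕ) : blkE α n α = 0 := by
  ext i b
  have := i.isLt
  simp only [blkE, Matrix.zero_apply]
  rw [if_neg]; omega

lemma blkE_mul_apply {α n q : ℕ} (k l : ℕ) (hl : l < α) (b : Fin n)
    (X : Matrix (Fin n) (Fin q) ℂ) (c : Fin q) :
    (blkE α n k * X) (ixx l hl b) c = if l = k then X b c else 0 := by
  rw [Matrix.mul_apply]
  by_cases h : l = k
  · subst h
    rw [if_pos rfl, Finset.sum_eq_single b]
    · simp [blkE, ixx]
    · intro b' _ hb'
      have : ¬ ((b : ℕ) + l * n = b' + l * n) := fun h => hb' (ixx_inj _ _ _ _ h).2.symm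
      change (if (b : ℕ) + l * n = b' + l * n then (1 : ℂ) else 0) * _ = 0
      rw [if_neg this, zero_mul]
    · simp
  · rw [if_neg h]
    apply Finset.sum_eq_zero
    intro b' _
    have : ¬ ((b : ℕ) + l * n = b' + k * n) := fun h' => h (ixx_inj _ _ _ _ h').1
    change (if (b : ℕ) + l * n = b' + k * n then (1 : ℂ) else 0) * _ = 0
    rw [if_neg this, zero_mul]

lemma bigA_mul (α n : ℕ) (hn : 1 ≤ n) (hα : 2 ≤ α)
    (N : Fin (α - 1) → Fin α → Matrix (Fin n) (Fin n) ℂ) (j : ℕ) (hj : j < α) :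
    bigA α n hn hα N * blkE α n j =
      ∑ i : Fin (α - 1), blkE α n (i + 1) * N i ⟨j, hj⟩ := by
  ext r c
  rw [mul_blkE _ _ hj, Matrix.sum_apply]
  obtain ⟨l, hl, b, rfl⟩ := ixx_surj r
  simp only [blkE_mul_apply]
  have hb := b.isLt
  rcases l with _ | l
  · rw [Finset.sum_eq_zero (by intro i _; simp)]
    simp [bigA, ixx]
  · rw [Finset.sum_eq_single ⟨l, by omega⟩]
    · have e : (b : ℕ) + (l + 1) * n - n = b + l * n := by
        have : (l + 1) * n = l * n + n := by ring
        omega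
      have e2 : ¬ ((b : ℕ) + (l + 1) * n < n) := by
        have : (l + 1) * n = l * n + n := by ring
        omega
      simp only [bigA, ixx, e, dif_neg e2, ixx_div, ixx_mod, if_true]
    · intro i _ hi
      rw [if_neg]
      intro h
      apply hi
      apply Fin.ext
      simp; omega
    · simp

/-- Top rows zero implies the form `bigA`. -/
lemma exists_bigA (α n : ℕ) (hn : 1 ≤ n) (hα : 2 ≤ α)
    (A : Matrix (Fin (α * n)) (Fin (α * n)) ℂ) :
    ∃ (N : Fin (α - 1) → Fin α → Matrix (Fin n) (Fin n) ℂ) (U : Matrix (Fin n) (Fin (α * n)) ℂ),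
      bigA α n hn hα N = A + bigC α n * U := by
  refine ⟨fun i j => Matrix.of fun b c => A (ixx (i + 1) (by omega) b) (ixx j j.isLt c),
    Matrix.of fun b j => - A (ixx 0 (by omega) b) j, ?_⟩
  apply blkE_ext
  intro k hk
  rw [bigA_mul _ _ _ _ _ _ hk]
  ext r c
  rw [mul_blkE _ _ hk, Matrix.sum_apply, Matrix.add_apply, bigC_eq]
  obtain ⟨l, hl, b, rfl⟩ := ixx_surj r
  simp only [blkE_mul_apply]
  rcases l with _ | l
  · rw [Finset.sum_eq_zero (by intro i _; simp)]
    simp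
  · rw [Finset.sum_eq_single ⟨l, by omega⟩]
    · simp
    · intro i _ hi
      rw [if_neg]
      intro h
      apply hi
      apply Fin.ext
      simp; omega
    · simp

lemma FST.mk' {m n : ℕ} {C C' : Matrix (Fin m) (Fin n) ℂ} {B A B' A' : Matrix (Fin m) (Fin m) ℂ}
    (S : Matrix (Fin m) (Fin m) ℂ) (P : Matrix (Fin n) (Fin n) ℂ)
    (U V : Matrix (Fin n) (Fin m) ℂ) (hS : IsUnit S) (hP : IsUnit P)
    (h1 : S * C' = C * P) (h2 : S * B' = B * S + C * V) (h3 : S * A' = A * S + C * U) :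
    FST (C, B, A) (C', B', A') := by
  have hd := (Matrix.isUnit_iff_isUnit_det S).1 hS
  refine ⟨S, P, U, V, hS, hP, ?_, ?_, ?_⟩
  · simp only
    rw [Matrix.mul_assoc, ← h1, Matrix.nonsing_inv_mul_cancel_left _ _ hd]
  · simp only
    rw [← h2, Matrix.nonsing_inv_mul_cancel_left _ _ hd]
  · simp only
    rw [← h3, Matrix.nonsing_inv_mul_cancel_left _ _ hd]

lemma FST.trans' {m n : ℕ} {X Y Z : TripleT m n} (h1 : FST X Y) (h2 : FST Y Z) : FST X Z := by
  obtain ⟨C, B, A⟩ := X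
  obtain ⟨S, P, U, V, hS, hP, e1, e2, e3⟩ := h1
  obtain ⟨S', P', U', V', hS', hP', f1, f2, f3⟩ := h2
  refine ⟨S * S', P * P', U * S' + P * U', V * S' + P * V', hS.mul hS', hP.mul hP', ?_, ?_, ?_⟩
  · rw [f1, e1, Matrix.mul_inv_rev]; simp only [Matrix.mul_assoc]
  · rw [f2, e1, e2, Matrix.mul_inv_rev]
    simp only [Matrix.mul_assoc, Matrix.mul_add, Matrix.add_mul, add_assoc]
  · rw [f3, e1, e3, Matrix.mul_inv_rev]
    simp only [Matrix.mul_assoc, Matrix.mul_add, Matrix.add_mul, add_assoc]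

lemma FST.closure {m n : ℕ} {X Y : TripleT m n} (h : FST X Y) (R : Set (TripleT m n))
    (hR : ∀ Z W, FST Z W → W ∈ R → Z ∈ R) (hY : Y ∈ closure R) : X ∈ closure R := by
  obtain ⟨C, B, A⟩ := X
  obtain ⟨C', B', A'⟩ := Y
  obtain ⟨S, P, U, V, hS, hP, e1, e2, e3⟩ := h
  have hSd := (Matrix.isUnit_iff_isUnit_det S).1 hS
  have hPd := (Matrix.isUnit_iff_isUnit_det P).1 hP
  simp only at e1 e2 e3
  let g : TripleT m n → TripleT m n := fun W =>
    (S * W.1 * P⁻¹, (S * W.2.1 - S * W.1 * P⁻¹ * V) * S⁻¹, (S * W.2.2 - S * W.1 * P⁻¹ * U) * S⁻¹)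
  have hg : Continuous g := by
    have c1 : Continuous (fun W : TripleT m n => W.1) := continuous_fst
    have c2 : Continuous (fun W : TripleT m n => W.2.1) := continuous_fst.comp continuous_snd
    have c3 : Continuous (fun W : TripleT m n => W.2.2) := continuous_snd.comp continuous_snd
    have d1 : Continuous (fun W : TripleT m n => S * W.1 * P⁻¹) :=
      (continuous_const.matrix_mul c1).matrix_mul continuous_const
    exact d1.prodMk
      ((((continuous_const.matrix_mul c2).sub (d1.matrix_mul continuous_const)).matrix_mul
        continuous_const).prodMk
      (((continuous_const.matrix_mul c3).sub (d1.matrix_mul continuous_const)).matrix_mul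
        continuous_const))
  have hgF : ∀ W, FST (g W) W := by
    intro W
    apply FST.mk' S P U V hS hP
    · rw [Matrix.nonsing_inv_mul_cancel_right _ _ hPd]
    · rw [Matrix.nonsing_inv_mul_cancel_right _ _ hSd]; abel
    · rw [Matrix.nonsing_inv_mul_cancel_right _ _ hSd]; abel
  have hgY : g (C', B', A') = (C, B, A) := by
    simp only [g]
    have q1 : S * C' * P⁻¹ = C := by
      rw [e1, Matrix.mul_assoc S⁻¹, Matrix.mul_nonsing_inv_cancel_left _ _ hSd,
        Matrix.mul_nonsing_inv_cancel_right _ _ hPd]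
    rw [q1, e2, e3, Matrix.mul_nonsing_inv_cancel_left _ _ hSd,
      Matrix.mul_nonsing_inv_cancel_left _ _ hSd, add_sub_cancel_right, add_sub_cancel_right,
      Matrix.mul_nonsing_inv_cancel_right _ _ hSd, Matrix.mul_nonsing_inv_cancel_right _ _ hSd]
  have : Set.MapsTo g R R := fun W hW => hR _ _ (hgF W) hW
  have := (this.closure hg) hY
  rwa [hgY] at this

/-- Row block `i`. -/
def rowB {α n q : ℕ} (Y : Matrix (Fin (α * n)) (Fin q) ℂ) (i : ℕ) : Matrix (Fin n) (Fin q) ℂ :=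
  Matrix.of fun b c => if h : i < α then Y (ixx i h b) c else 0

lemma sum_rowB {α n q : ℕ} (Y : Matrix (Fin (α * n)) (Fin q) ℂ) :
    Y = ∑ i ∈ Finset.range α, blkE α n i * rowB Y i := by
  ext r c
  rw [Matrix.sum_apply]
  obtain ⟨l, hl, b, rfl⟩ := ixx_surj r
  simp only [blkE_mul_apply]
  rw [Finset.sum_ite_eq, if_pos (Finset.mem_range.2 hl)]
  simp [rowB, hl]

/-- The recursive sequence of blocks. -/
def seqS {m n : ℕ} (C : Matrix (Fin m) (Fin n) ℂ) (B : Matrix (Fin m) (Fin m) ℂ)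
    (V : ℕ → Matrix (Fin n) (Fin n) ℂ) : ℕ → Matrix (Fin m) (Fin n) ℂ
  | 0 => C
  | k + 1 => B * seqS C B V k + C * V k

lemma seqS_eq {m n : ℕ} (C : Matrix (Fin m) (Fin n) ℂ) (B : Matrix (Fin m) (Fin m) ℂ)
    (V : ℕ → Matrix (Fin n) (Fin n) ℂ) (k : ℕ) :
    seqS C B V k = B ^ k * C + ∑ i ∈ Finset.range k, B ^ i * C * V (k - 1 - i) := by
  induction k with
  | zero => simp [seqS]
  | succ k ih =>
    rw [seqS, ih, Finset.sum_range_succ', Matrix.mul_add, Matrix.mul_sum]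
    have : ∀ i ∈ Finset.range k, B * (B ^ i * C * V (k - 1 - i)) =
        B ^ (i + 1) * C * V (k + 1 - 1 - (i + 1)) := by
      intro i _
      rw [show k + 1 - 1 - (i + 1) = k - 1 - i by omega, pow_succ']
      simp only [Matrix.mul_assoc]
    rw [Finset.sum_congr rfl this, pow_succ']
    simp [Matrix.mul_assoc, add_assoc]

lemma reduceK {α n : ℕ} (hn : 1 ≤ n) (hα : 2 ≤ α) (C : Matrix (Fin (α * n)) (Fin n) ℂ)
    (B A : Matrix (Fin (α * n)) (Fin (α * n)) ℂ)
    (hK : (catM (fun k => B ^ k * C) : Matrix (Fin (α * n)) (Fin (α * n)) ℂ).det ≠ 0) :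
    ∃ N, FST (C, B, A) (bigC α n, bigB α n, bigA α n hn hα N) := by
  set K : Matrix (Fin (α * n)) (Fin (α * n)) ℂ := catM (fun k => B ^ k * C) with hKd
  let Y := K⁻¹ * (B ^ α * C)
  have hY : B ^ α * C = ∑ i ∈ Finset.range α, B ^ i * C * rowB Y i := by
    have h1 : K * Y = B ^ α * C := Matrix.mul_nonsing_inv_cancel_left _ _ (isUnit_iff_ne_zero.2 hK)
    rw [← h1]
    conv_lhs => rw [sum_rowB Y, Matrix.mul_sum]
    apply Finset.sum_congr rfl
    intro i hi
    rw [← Matrix.mul_assoc, hKd, catM_mul _ _ (Finset.mem_range.1 hi)]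
  let V : ℕ → Matrix (Fin n) (Fin n) ℂ := fun i => - rowB Y (α - 1 - i)
  have hlast : seqS C B V α = 0 := by
    rw [seqS_eq, hY, ← Finset.sum_add_distrib]
    apply Finset.sum_eq_zero
    intro i hi
    have := Finset.mem_range.1 hi
    simp only [V]
    rw [show α - 1 - (α - 1 - i) = i by omega]
    simp
  let S : Matrix (Fin (α * n)) (Fin (α * n)) ℂ := catM (seqS C B V)
  have hSk : ∀ k < α, S * blkE α n k = seqS C B V k := fun k hk => catM_mul _ _ hk
  have hex : ∀ k, ∃ Z : Matrix (Fin (α * n)) (Fin n) ℂ, k < α → B ^ k * C = S * Z := by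
    intro k
    induction k using Nat.strong_induction_on with
    | _ k ih =>
      by_cases hk : k < α
      · choose! Z hZ using ih
        refine ⟨blkE α n k - ∑ i ∈ Finset.range k, Z i * V (k - 1 - i), fun _ => ?_⟩
        rw [Matrix.mul_sub, hSk k hk, seqS_eq, Matrix.mul_sum]
        rw [eq_sub_iff_add_eq]
        congr 1
        apply Finset.sum_congr rfl
        intro i hi
        have := Finset.mem_range.1 hi
        rw [hZ i this (by omega), Matrix.mul_assoc]
      · exact ⟨0, fun h => absurd h hk⟩
  choose Z hZ using hex
  have hKS : K = S * catM Z := by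
    apply blkE_ext
    intro k hk
    rw [Matrix.mul_assoc, catM_mul _ _ hk, catM_mul _ _ hk, hZ k hk]
  have hS : IsUnit S := by
    rw [Matrix.isUnit_iff_isUnit_det, isUnit_iff_ne_zero]
    intro h
    rw [hKS, Matrix.det_mul, h, zero_mul] at hK
    exact hK rfl
  have hSd := (Matrix.isUnit_iff_isUnit_det S).1 hS
  obtain ⟨N, U, hN⟩ := exists_bigA α n hn hα (S⁻¹ * A * S)
  refine ⟨N, FST.mk' S 1 U (catM V) hS isUnit_one ?_ ?_ ?_⟩
  · rw [bigC_eq, hSk 0 (by omega)]; simp [seqS]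
  · apply blkE_ext
    intro k hk
    rw [Matrix.mul_assoc, bigB_mul _ _ _ hk, Matrix.add_mul, Matrix.mul_assoc, hSk k hk,
      Matrix.mul_assoc, catM_mul _ _ hk]
    by_cases hk' : k + 1 < α
    · rw [hSk _ hk']; rfl
    · have : k + 1 = α := by omega
      rw [this, blkE_last, Matrix.mul_zero]
      have h2 : seqS C B V (k + 1) = 0 := (congrArg (seqS C B V) this).trans hlast
      exact h2.symm
  · have hC : S * bigC α n = C := by rw [bigC_eq, hSk 0 (by omega)]; rfl
    rw [hN, Matrix.mul_add, ← Matrix.mul_assoc S (bigC α n), hC, Matrix.mul_assoc S⁻¹,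
      Matrix.mul_nonsing_inv_cancel_left _ _ hSd]

lemma conj_FST {α n : ℕ} (hn : 1 ≤ n) (hα : 2 ≤ α)
    (N N' : Fin (α - 1) → Fin α → Matrix (Fin n) (Fin n) ℂ) (P : Matrix (Fin n) (Fin n) ℂ)
    (hP : IsUnit P) (h : ∀ i j, P * N' i j = N i j * P) :
    FST (bigC α n, bigB α n, bigA α n hn hα N) (bigC α n, bigB α n, bigA α n hn hα N') := by
  let S : Matrix (Fin n) (Fin n) ℂ → Matrix (Fin (α * n)) (Fin (α * n)) ℂ :=
    fun P => catM (fun k => blkE α n k * P)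
  have hSk : ∀ P, ∀ k < α, S P * blkE α n k = blkE α n k * P := fun P k hk => catM_mul _ _ hk
  have hPd := (Matrix.isUnit_iff_isUnit_det P).1 hP
  have h1 : S P * S P⁻¹ = 1 := by
    apply blkE_ext
    intro k hk
    rw [Matrix.mul_assoc, hSk _ _ hk, ← Matrix.mul_assoc, hSk _ _ hk, Matrix.mul_assoc,
      Matrix.mul_nonsing_inv _ hPd, Matrix.mul_one, Matrix.one_mul]
  have hS : IsUnit (S P) := IsUnit.of_mul_eq_one _ h1
  refine FST.mk' (S P) P 0 0 hS hP ?_ ?_ ?_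
  · rw [bigC_eq, hSk _ _ (by omega)]
  · apply blkE_ext
    intro k hk
    rw [Matrix.mul_zero, add_zero, Matrix.mul_assoc, Matrix.mul_assoc, hSk _ _ hk, bigB_mul _ _ _ hk,
      ← Matrix.mul_assoc, bigB_mul _ _ _ hk]
    by_cases hk' : k + 1 < α
    · rw [hSk _ _ hk']
    · have : k + 1 = α := by omega
      rw [this, blkE_last, Matrix.mul_zero, Matrix.zero_mul]
  · apply blkE_ext
    intro k hk
    rw [Matrix.mul_zero, add_zero, Matrix.mul_assoc, Matrix.mul_assoc, hSk _ _ hk,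
      bigA_mul _ _ _ _ _ _ hk, ← Matrix.mul_assoc, bigA_mul _ _ _ _ _ _ hk, Matrix.mul_sum,
      Matrix.sum_mul]
    apply Finset.sum_congr rfl
    intro i _
    rw [← Matrix.mul_assoc, hSk _ _ (by omega), Matrix.mul_assoc, h, Matrix.mul_assoc]

lemma dense_K {α n : ℕ} (T : TripleT (α * n) n) :
    T ∈ closure {T : TripleT (α * n) n |
      (catM (fun k => T.2.1 ^ k * T.1) : Matrix (Fin (α * n)) (Fin (α * n)) ℂ).det ≠ 0} := by
  obtain ⟨C, B, A⟩ := T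
  let LC : Matrix (Fin (α * n)) (Fin n) (Polynomial ℂ) :=
    C.map Polynomial.C + (Polynomial.X : Polynomial ℂ) • (bigC α n - C).map Polynomial.C
  let LB : Matrix (Fin (α * n)) (Fin (α * n)) (Polynomial ℂ) :=
    B.map Polynomial.C + (Polynomial.X : Polynomial ℂ) • (bigB α n - B).map Polynomial.C
  have hLC : ∀ t : ℂ, LC.map (Polynomial.evalRingHom t) = C + t • (bigC α n - C) := by
    intro t
    ext i j
    simp [LC]
  have hLB : ∀ t : ℂ, LB.map (Polynomial.evalRingHom t) = B + t • (bigB α n - B) := by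
    intro t
    ext i j
    simp [LB]
  let p : Polynomial ℂ :=
    (catM (fun k => LB ^ k * LC) : Matrix (Fin (α * n)) (Fin (α * n)) (Polynomial ℂ)).det
  have hp : ∀ t : ℂ, p.eval t = (catM (fun k => (B + t • (bigB α n - B)) ^ k *
      (C + t • (bigC α n - C))) : Matrix (Fin (α * n)) (Fin (α * n)) ℂ).det := by
    intro t
    rw [← Polynomial.coe_evalRingHom, RingHom.map_det]
    congr 1
    ext i j
    have h1 : (LB ^ (j.divNat : ℕ) * LC).map (Polynomial.evalRingHom t) =
      (B + t • (bigB α n - B)) ^ (j.divNat : ℕ) * (C + t • (bigC α n - C)) := by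
      rw [Matrix.map_mul, Matrix.map_pow, hLB, hLC]
    have h2 := congrFun (congrFun h1 i) j.modNat
    exact h2
  have h1 : p.eval 1 ≠ 0 := by
    rw [hp]
    have e1 : B + (1:ℂ) • (bigB α n - B) = bigB α n := by simp
    have e2 : C + (1:ℂ) • (bigC α n - C) = bigC α n := by simp
    rw [e1, e2]
    have e3 : ∀ k ≤ α, bigB α n ^ k * bigC α n = blkE α n k := by
      intro k
      induction k with
      | zero => intro _; simp [bigC_eq]
      | succ k ih =>
        intro hk
        rw [pow_succ', Matrix.mul_assoc, ih (by omega), bigB_mul _ _ _ (by omega)]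
    have e4 : (catM (fun k => bigB α n ^ k * bigC α n) :
        Matrix (Fin (α * n)) (Fin (α * n)) ℂ) = 1 := by
      apply blkE_ext
      intro k hk
      rw [catM_mul _ _ hk, e3 k hk.le, Matrix.one_mul]
    rw [e4]; simp
  have := mem_closure_path (fun t : ℂ => ((C + t • (bigC α n - C), B + t • (bigB α n - B), A) :
      TripleT (α * n) n)) (by fun_prop) {T : TripleT (α * n) n |
      (catM (fun k => T.2.1 ^ k * T.1) : Matrix (Fin (α * n)) (Fin (α * n)) ℂ).det ≠ 0} _
      (dense_poly p h1) (fun t ht => by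
        have h := ht
        simp only [Set.mem_ofPred_eq] at h ⊢
        rwa [hp] at h)
  simpa using this

lemma continuous_bigA {α n : ℕ} (hn : 1 ≤ n) (hα : 2 ≤ α) :
    Continuous (fun N : Fin (α - 1) → Fin α → Matrix (Fin n) (Fin n) ℂ =>
      ((bigC α n, bigB α n, bigA α n hn hα N) : TripleT (α * n) n)) := by
  refine continuous_const.prodMk (continuous_const.prodMk ?_)
  refine continuous_pi fun i => continuous_pi fun j => ?_
  simp only [bigA]
  split_ifs
  · exact continuous_const
  · refine Continuous.matrix_elem ?_ _ _
    have hi : ((i : ℕ) - n) / n < α - 1 := by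
      obtain ⟨k, hk, b, rfl⟩ := ixx_surj i
      have hb := b.isLt
      rcases k with _ | k
      · rename_i h
        exact absurd (by simp [ixx]) h
      · have e : ((ixx (k + 1) hk b : Fin (α * n)) : ℕ) - n = b + k * n := by
          have : (k + 1) * n = k * n + n := by ring
          simp only [ixx]
          omega
        rw [e, ixx_div]
        omega
    have key : ∀ (x : Fin (α - 1)) (y : Fin α), Continuous
        (fun N : Fin (α - 1) → Fin α → Matrix (Fin n) (Fin n) ℂ => N x y) :=
      fun x y => (continuous_apply y).comp (continuous_apply x)
    exact key ⟨((i : ℕ) - n) / n, hi⟩ j.divNat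

/-- The set of triples feedback similar to a normal form. -/
def goodR (α n : ℕ) (hn : 1 ≤ n) (hα : 2 ≤ α) : Set (TripleT (α * n) n) :=
  {T | ∃ (lam : Fin n → ℂ) (N : Fin (α - 1) → Fin α → Matrix (Fin n) (Fin n) ℂ),
      Function.Injective lam ∧
      N ⟨0, by omega⟩ ⟨0, by omega⟩ = Matrix.diagonal lam ∧
      (∀ j : Fin n, 1 ≤ (j:ℕ) → N ⟨0, by omega⟩ ⟨1, by omega⟩ ⟨0, by omega⟩ j = 1) ∧
      FST T (bigC α n, bigB α n, bigA α n hn hα N)}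

lemma goodR_FST {α n : ℕ} (hn : 1 ≤ n) (hα : 2 ≤ α) (Z W : TripleT (α * n) n) (h : FST Z W)
    (hW : W ∈ goodR α n hn hα) : Z ∈ goodR α n hn hα := by
  obtain ⟨lam, N, h1, h2, h3, h4⟩ := hW
  exact ⟨lam, N, h1, h2, h3, h.trans' h4⟩

/-- Diagonal `N₁₁`, nonzero relevant entries of `N₁₂`. -/
lemma good_scale {α n : ℕ} (hn : 1 ≤ n) (hα : 2 ≤ α)
    (N : Fin (α - 1) → Fin α → Matrix (Fin n) (Fin n) ℂ) (lam : Fin n → ℂ)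
    (hl : Function.Injective lam) (h0 : N ⟨0, by omega⟩ ⟨0, by omega⟩ = Matrix.diagonal lam)
    (h1 : ∀ j : Fin n, N ⟨0, by omega⟩ ⟨1, by omega⟩ ⟨0, by omega⟩ j ≠ 0) :
    ((bigC α n, bigB α n, bigA α n hn hα N) : TripleT (α * n) n) ∈ goodR α n hn hα := by
  let d : Fin n → ℂ := fun j => if (j : ℕ) = 0 then 1 else
    (N ⟨0, by omega⟩ ⟨1, by omega⟩ ⟨0, by omega⟩ j)⁻¹
  have hd : ∀ j, d j ≠ 0 := by
    intro j
    simp only [d]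
    split_ifs
    · exact one_ne_zero
    · exact inv_ne_zero (h1 j)
  let e : Fin n → ℂ := fun j => (d j)⁻¹
  have hde : Matrix.diagonal d * Matrix.diagonal e = 1 := by
    rw [Matrix.diagonal_mul_diagonal, ← Matrix.diagonal_one]
    congr 1
    ext j
    exact mul_inv_cancel₀ (hd j)
  refine ⟨lam, fun i j => Matrix.diagonal e * N i j * Matrix.diagonal d, hl, ?_, ?_, ?_⟩
  · simp only
    rw [h0, Matrix.diagonal_mul_diagonal, Matrix.diagonal_mul_diagonal]
    congr 1
    ext j
    simp only [e]
    field_simp [hd j]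
  · intro j hj
    simp only [Matrix.mul_diagonal, Matrix.diagonal_mul]
    have : d j = (N ⟨0, by omega⟩ ⟨1, by omega⟩ ⟨0, by omega⟩ j)⁻¹ := by
      simp only [d]; rw [if_neg (by omega)]
    rw [this]
    have : e ⟨0, by omega⟩ = 1 := by simp [e, d]
    rw [this, one_mul, mul_inv_cancel₀ (h1 j)]
  · refine conj_FST hn hα _ _ (Matrix.diagonal d) (IsUnit.of_mul_eq_one _ hde) ?_
    intro i j
    simp only [← Matrix.mul_assoc]
    rw [hde, Matrix.one_mul]

lemma good_diag {α n : ℕ} (hn : 1 ≤ n) (hα : 2 ≤ α)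
    (N : Fin (α - 1) → Fin α → Matrix (Fin n) (Fin n) ℂ) (lam : Fin n → ℂ)
    (hl : Function.Injective lam) (h0 : N ⟨0, by omega⟩ ⟨0, by omega⟩ = Matrix.diagonal lam) :
    ((bigC α n, bigB α n, bigA α n hn hα N) : TripleT (α * n) n) ∈ closure (goodR α n hn hα) := by
  let J : Fin (α - 1) → Fin α → Matrix (Fin n) (Fin n) ℂ := fun _ j =>
    if (j : ℕ) = 0 then 0 else Matrix.of fun _ _ => 1
  have hfin : Set.Countable (Set.range fun j : Fin n =>
      - N ⟨0, by omega⟩ ⟨1, by omega⟩ ⟨0, by omega⟩ j) := Set.countable_range _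
  have := mem_closure_path (fun t : ℂ => ((bigC α n, bigB α n, bigA α n hn hα (N + t • J)) :
      TripleT (α * n) n)) ((continuous_bigA hn hα).comp (by fun_prop)) (goodR α n hn hα) _
      (hfin.dense_compl ℂ) (by
        intro t ht
        apply good_scale hn hα _ lam hl
        · simp [J, h0]
        · intro j hj
          apply ht
          refine ⟨j, ?_⟩
          simp [J] at hj
          simp only
          linear_combination -hj)
  simpa using this

lemma good_all {α n : ℕ} (hn : 1 ≤ n) (hα : 2 ≤ α)
    (N : Fin (α - 1) → Fin α → Matrix (Fin n) (Fin n) ℂ) :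
    ((bigC α n, bigB α n, bigA α n hn hα N) : TripleT (α * n) n) ∈ closure (goodR α n hn hα) := by
  let f : Matrix (Fin n) (Fin n) ℂ → TripleT (α * n) n := fun M =>
    (bigC α n, bigB α n, bigA α n hn hα (Function.update N ⟨0, by omega⟩
      (Function.update (N ⟨0, by omega⟩) ⟨0, by omega⟩ M)))
  have hf : Continuous f := (continuous_bigA hn hα).comp
    (continuous_const.update _ (continuous_const.update _ continuous_id))
  have hm : Set.MapsTo f {M | ∃ (lam : Fin n → ℂ) (Q : Matrix (Fin n) (Fin n) ℂ),
      Function.Injective lam ∧ IsUnit Q ∧ M * Q = Q * Matrix.diagonal lam}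
      (closure (goodR α n hn hα)) := by
    rintro M ⟨lam, Q, hl, hQ, hMQ⟩
    have hQd := (Matrix.isUnit_iff_isUnit_det Q).1 hQ
    refine FST.closure (conj_FST hn hα _ (fun i j => Q⁻¹ * (Function.update N ⟨0, by omega⟩
      (Function.update (N ⟨0, by omega⟩) ⟨0, by omega⟩ M)) i j * Q) Q hQ ?_) _
      (goodR_FST hn hα) (good_diag hn hα _ lam hl ?_)
    · intro i j
      rw [Matrix.mul_assoc, Matrix.mul_nonsing_inv_cancel_left _ _ hQd]
    · simp only [Function.update_self]
      rw [Matrix.mul_assoc, hMQ, Matrix.nonsing_inv_mul_cancel_left _ _ hQd]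
  have := (hm.closure hf) (dense_diag (N ⟨0, by omega⟩ ⟨0, by omega⟩))
  rw [closure_closure] at this
  simpa [f] using this

lemma continuous_fnorm {p q : ℕ} : Continuous (fnorm : Matrix (Fin p) (Fin q) ℂ → ℝ) := by
  unfold fnorm
  fun_prop

lemma continuous_tnorm {m n : ℕ} : Continuous (tnorm : TripleT m n → ℝ) := by
  unfold tnorm
  exact ((continuous_fnorm.comp continuous_fst).add
    (continuous_fnorm.comp (continuous_fst.comp continuous_snd))).add
    (continuous_fnorm.comp (continuous_snd.comp continuous_snd))

/-- second part of Theorem 9 of the paper. -/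
theorem stmt10 (n α : ℕ) (hn : 1 ≤ n) (hα : 2 ≤ α)
    (T : TripleT (α * n) n) (ε : ℝ) (hε : 0 < ε) :
    ∃ (Δ : TripleT (α * n) n) (lam : Fin n → ℂ)
      (N : Fin (α - 1) → Fin α → Matrix (Fin n) (Fin n) ℂ),
      tnorm Δ < ε ∧
      Function.Injective lam ∧
      N ⟨0, by omega⟩ ⟨0, by omega⟩ = Matrix.diagonal lam ∧
      (∀ j : Fin n, 1 ≤ (j:ℕ) → N ⟨0, by omega⟩ ⟨1, by omega⟩ ⟨0, by omega⟩ j = 1) ∧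
      FST (T + Δ) (bigC α n, bigB α n, bigA α n hn hα N) := by
  have hT : T ∈ closure (goodR α n hn hα) := by
    have hsub : {T : TripleT (α * n) n |
        (catM (fun k => T.2.1 ^ k * T.1) : Matrix (Fin (α * n)) (Fin (α * n)) ℂ).det ≠ 0} ⊆
        closure (goodR α n hn hα) := by
      rintro ⟨C, B, A⟩ hK
      obtain ⟨N, hN⟩ := reduceK hn hα C B A hK
      exact hN.closure _ (goodR_FST hn hα) (good_all hn hα N)
    exact closure_minimal hsub isClosed_closure (dense_K T)
  have hopen : IsOpen {X : TripleT (α * n) n | tnorm (X - T) < ε} :=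
    isOpen_lt (continuous_tnorm.comp (continuous_id.sub continuous_const)) continuous_const
  have hmem : T ∈ {X : TripleT (α * n) n | tnorm (X - T) < ε} := by
    simp [tnorm, fnorm, hε]
  obtain ⟨X, hX1, lam, N, h1, h2, h3, h4⟩ := mem_closure_iff.1 hT _ hopen hmem
  exact ⟨X - T, lam, N, hX1, h1, h2, h3, by rwa [add_sub_cancel]⟩
end

section
/- Let m and n be positive integers with m < n(1+√5)/2. Then: (i) there is exactly one m×(n,m,m) triple of the form ℒ^{(l)}(F_{pq}, 0_p, 0_p) with integers l ≥ 0 and 0 ≤ p ≤ q; (ii) the set of all m×(n,m,m) triples that are feedback similar to this triple is open and everywhere dense in the space ℂ^{m×(n,m,m)} of all m×(n,m,m) triples, and it coincides with the set of all m×(n,m,m) triples that are rigid with respect to feedback similarity. -/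
open Matrix

/-- `F_{pq} = [I_p 0_{p,q-p}]` (for `p ≤ q`), entrywise: entry 1 iff `i = j`. -/
def Fmat (p q : ℕ) : Matrix (Fin p) (Fin q) ℂ := fun i j =>
  if (i:ℕ) = (j:ℕ) then 1 else 0

/-- For a `p×(q,p,p)` triple `(C,B,A)`, the `(2p+q)×(p+q,2p+q,2p+q)` triple
`ℒ(C,B,A) = ([I_{p+q}; 0], [0; [0_{p,q} I_p 0_{p,p}]], [0; [C B A]])`,
written entrywise. -/
def Ltriple {p q : ℕ} (T : TripleT p q) : TripleT (2*p+q) (p+q) :=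
  (fun i j => if (i:ℕ) = (j:ℕ) then 1 else 0,
   fun i j => if p + q ≤ (i:ℕ) ∧ (j:ℕ) + p = (i:ℕ) then 1 else 0,
   fun i j =>
     if hi : (i:ℕ) < p + q then 0
     else if hj : (j:ℕ) < q then
       T.1 ⟨(i:ℕ) - (p+q), by have := i.isLt; omega⟩ ⟨j, hj⟩
     else if hj2 : (j:ℕ) < q + p then
       T.2.1 ⟨(i:ℕ) - (p+q), by have := i.isLt; omega⟩ ⟨(j:ℕ) - q, by omega⟩
     else
       T.2.2 ⟨(i:ℕ) - (p+q), by have := i.isLt; omega⟩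
         ⟨(j:ℕ) - (q+p), by have := j.isLt; omega⟩)

/-- Triples of arbitrary sizes, bundled with their sizes. -/
def TripleS := Σ p : ℕ, Σ q : ℕ, TripleT p q

/-- The operation `ℒ` on size-bundled triples. -/
def Lop : TripleS → TripleS := fun x => ⟨2 * x.1 + x.2.1, x.1 + x.2.1, Ltriple x.2.2⟩

/-- `T` is of the form `ℒ^{(l)}(F_{pq}, 0_p, 0_p)`. -/
def IsLform (m n : ℕ) (T : TripleT m n) : Prop :=
  ∃ (l p q : ℕ), p ≤ q ∧ Lop^[l] ⟨p, q, (Fmat p q, 0, 0)⟩ = ⟨m, n, T⟩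

/-- A triple is rigid with respect to feedback similarity if all triples in some
`ε`-neighbourhood of it are feedback similar to it. -/
def RigidT {m n : ℕ} (X : TripleT m n) : Prop :=
  ∃ ε : ℝ, 0 < ε ∧ ∀ Y : TripleT m n, tnorm (Y - X) < ε → FST Y X

set_option linter.unusedSectionVars false

namespace FeedbackAux

open Filter Topology

/-- Triples over arbitrary index types. -/
abbrev GT (ι κ : Type) := Matrix ι κ ℂ × Matrix ι ι ℂ × Matrix ι ι ℂ

section gen
variable {ι κ ι' κ' α β μ : Type} [Fintype ι] [DecidableEq ι] [Fintype κ] [DecidableEq κ]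
  [Fintype ι'] [DecidableEq ι'] [Fintype κ'] [DecidableEq κ']
  [Fintype α] [DecidableEq α] [Fintype β] [DecidableEq β] [Fintype μ] [DecidableEq μ]

/-- The action defining feedback similarity (`S'` is meant to be the inverse of `S`). -/
def act (S S' : Matrix ι ι ℂ) (P : Matrix κ κ ℂ) (U V : Matrix κ ι ℂ) (X : GT ι κ) : GT ι κ :=
  (S' * X.1 * P, S' * (X.2.1 * S + X.1 * V), S' * (X.2.2 * S + X.1 * U))

/-- Feedback similarity over arbitrary index types. -/
def GF (X Y : GT ι κ) : Prop :=
  ∃ (S S' : Matrix ι ι ℂ) (P P' : Matrix κ κ ℂ) (U V : Matrix κ ι ℂ),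
    S * S' = 1 ∧ S' * S = 1 ∧ P * P' = 1 ∧ P' * P = 1 ∧ Y = act S S' P U V X

lemma GF.symm {X Y : GT ι κ} (h : GF X Y) : GF Y X := by
  obtain ⟨S, S', P, P', U, V, h1, h2, h3, h4, rfl⟩ := h
  have e1 : ∀ {γ : Type} (M : Matrix ι γ ℂ), S * (S' * M) = M := fun M => by
    rw [← Matrix.mul_assoc, h1, Matrix.one_mul]
  have e3 : ∀ {γ : Type} (M : Matrix κ γ ℂ), P * (P' * M) = M := fun M => by
    rw [← Matrix.mul_assoc, h3, Matrix.one_mul]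
  refine ⟨S', S, P', P, -(P' * U * S'), -(P' * V * S'), h2, h1, h4, h3, ?_⟩
  obtain ⟨C, B, A⟩ := X
  simp only [act]
  refine Prod.ext ?_ (Prod.ext ?_ ?_) <;>
    simp [Matrix.mul_assoc, Matrix.mul_add, Matrix.add_mul, e1, e3, h1, h3]

lemma GF.trans {X Y Z : GT ι κ} (h : GF X Y) (h' : GF Y Z) : GF X Z := by
  obtain ⟨S, S', P, P', U, V, h1, h2, h3, h4, rfl⟩ := h
  obtain ⟨R, R', Q, Q', U2, V2, k1, k2, k3, k4, rfl⟩ := h'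
  refine ⟨S * R, R' * S', P * Q, Q' * P', U * R + P * U2, V * R + P * V2, ?_, ?_, ?_, ?_, ?_⟩
  · rw [Matrix.mul_assoc, ← Matrix.mul_assoc R, k1, Matrix.one_mul, h1]
  · rw [Matrix.mul_assoc, ← Matrix.mul_assoc S', h2, Matrix.one_mul, k2]
  · rw [Matrix.mul_assoc, ← Matrix.mul_assoc Q, k3, Matrix.one_mul, h3]
  · rw [Matrix.mul_assoc, ← Matrix.mul_assoc P', h4, Matrix.one_mul, k4]
  · obtain ⟨C, B, A⟩ := X
    simp only [act]
    refine Prod.ext ?_ (Prod.ext ?_ ?_) <;>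
      simp [Matrix.mul_assoc, Matrix.mul_add, Matrix.add_mul, add_assoc]

lemma continuous_act (S S' : Matrix ι ι ℂ) (P : Matrix κ κ ℂ) (U V : Matrix κ ι ℂ) :
    Continuous (act S S' P U V) := by
  unfold act; fun_prop

/-- Goodness: dense orbit, containing a neighbourhood of the base point. -/
def Good (T : GT ι κ) : Prop := Dense {X | GF X T} ∧ ∀ᶠ X in 𝓝 T, GF X T

lemma closure_sat {T X Y : GT ι κ} (h : GF X Y) (hX : X ∈ closure {Z | GF Z T}) :
    Y ∈ closure {Z | GF Z T} := by
  obtain ⟨S, S', P, P', U, V, h1, h2, h3, h4, rfl⟩ := h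
  refine map_mem_closure (continuous_act S S' P U V) hX fun Z hZ => ?_
  exact GF.trans (GF.symm ⟨S, S', P, P', U, V, h1, h2, h3, h4, rfl⟩) hZ

lemma nhds_sat {T X Y : GT ι κ} (h : GF X Y) (hY : ∀ᶠ Z in 𝓝 Y, GF Z T) :
    ∀ᶠ Z in 𝓝 X, GF Z T := by
  obtain ⟨S, S', P, P', U, V, h1, h2, h3, h4, rfl⟩ := h
  filter_upwards [(continuous_act S S' P U V).continuousAt.eventually hY] with Z hZ
  exact GF.trans ⟨S, S', P, P', U, V, h1, h2, h3, h4, rfl⟩ hZ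

/-- Reindexing of triples. -/
def rei (e : ι ≃ ι') (f : κ ≃ κ') (X : GT ι κ) : GT ι' κ' :=
  (X.1.submatrix e.symm f.symm, X.2.1.submatrix e.symm e.symm, X.2.2.submatrix e.symm e.symm)

lemma continuous_rei (e : ι ≃ ι') (f : κ ≃ κ') : Continuous (rei e f) := by
  unfold rei; fun_prop

lemma rei_symm (e : ι ≃ ι') (f : κ ≃ κ') (X : GT ι' κ') : rei e f (rei e.symm f.symm X) = X := by
  simp [rei]

lemma rei_symm' (e : ι ≃ ι') (f : κ ≃ κ') (X : GT ι κ) : rei e.symm f.symm (rei e f X) = X := by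
  simp [rei]

lemma GF.rei {X Y : GT ι κ} (h : GF X Y) (e : ι ≃ ι') (f : κ ≃ κ') :
    GF (rei e f X) (rei e f Y) := by
  obtain ⟨S, S', P, P', U, V, h1, h2, h3, h4, rfl⟩ := h
  refine ⟨S.submatrix e.symm e.symm, S'.submatrix e.symm e.symm, P.submatrix f.symm f.symm,
    P'.submatrix f.symm f.symm, U.submatrix f.symm e.symm, V.submatrix f.symm e.symm,
    ?_, ?_, ?_, ?_, ?_⟩
  · rw [Matrix.submatrix_mul_equiv, h1, Matrix.submatrix_one_equiv]
  · rw [Matrix.submatrix_mul_equiv, h2, Matrix.submatrix_one_equiv]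
  · rw [Matrix.submatrix_mul_equiv, h3, Matrix.submatrix_one_equiv]
  · rw [Matrix.submatrix_mul_equiv, h4, Matrix.submatrix_one_equiv]
  · simp only [act, FeedbackAux.rei, Matrix.submatrix_mul_equiv, ← Matrix.submatrix_add]
    refine Prod.ext ?_ (Prod.ext ?_ ?_) <;>
    simp [Matrix.submatrix_mul_equiv, ← Matrix.submatrix_add, ← Pi.add_apply]

lemma Good.rei {T : GT ι κ} (h : Good T) (e : ι ≃ ι') (f : κ ≃ κ') : Good (rei e f T) := by
  constructor
  · intro X
    rw [← rei_symm e f X]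
    exact map_mem_closure (continuous_rei e f) (h.1 _) fun Z hZ => GF.rei hZ e f
  · have h2 := h.2
    rw [← rei_symm' e f T] at h2
    filter_upwards [(continuous_rei e.symm f.symm).continuousAt.eventually h2] with X hX
    have := GF.rei hX e f
    rwa [rei_symm, rei_symm, ] at this

lemma dense_units : Dense {M : Matrix ι ι ℂ | IsUnit M.det} := by
  intro M
  have hd : Dense ({t : ℂ | M.charpoly.IsRoot t}ᶜ) := by
    exact Set.Countable.dense_compl ℂ
      (Polynomial.finite_setOfPred_isRoot M.charpoly_monic.ne_zero).countable
  have hc : Continuous fun t : ℂ => M - Matrix.scalar ι t := by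
    simp only [Matrix.scalar_apply]; fun_prop
  have := map_mem_closure (t := {M : Matrix ι ι ℂ | IsUnit M.det}) hc (hd 0) ?_
  · simpa using this
  · intro t ht
    have h1 : ¬ M.charpoly.eval t = 0 := ht
    rw [Matrix.eval_charpoly] at h1
    show IsUnit (M - Matrix.scalar ι t).det
    rw [← neg_sub, Matrix.det_neg, isUnit_iff_ne_zero]
    exact mul_ne_zero (pow_ne_zero _ (by norm_num)) h1

lemma contAt_inv_one : ContinuousAt (Inv.inv : Matrix ι ι ℂ → Matrix ι ι ℂ) 1 := by
  apply continuousAt_matrix_inv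
  rw [Ring.inverse_eq_inv', Matrix.det_one]
  exact continuousAt_inv₀ one_ne_zero

lemma eventually_unit : ∀ᶠ M in 𝓝 (1 : Matrix ι ι ℂ), IsUnit M.det := by
  have : Continuous fun M : Matrix ι ι ℂ => M.det := by fun_prop
  have h := this.continuousAt (x := 1) |>.eventually_ne (y := 0) (by simp)
  filter_upwards [h] with M hM using isUnit_iff_ne_zero.2 hM

/-- Base case. -/
lemma base_gf (C1 C1' : Matrix ι ι ℂ) (C2 : Matrix ι μ ℂ) (B A : Matrix ι ι ℂ)
    (h1 : C1 * C1' = 1) (h2 : C1' * C1 = 1) :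
    GF ((fromCols C1 C2, B, A) : GT ι (ι ⊕ μ)) (fromCols 1 0, 0, 0) := by
  have e1 : ∀ {γ : Type} (M : Matrix ι γ ℂ), C1 * (C1' * M) = M := fun M => by
    rw [← Matrix.mul_assoc, h1, Matrix.one_mul]
  have e2 : ∀ {γ : Type} (M : Matrix ι γ ℂ), C1' * (C1 * M) = M := fun M => by
    rw [← Matrix.mul_assoc, h2, Matrix.one_mul]
  refine ⟨1, 1, fromBlocks C1' (-(C1' * C2)) 0 1, fromBlocks C1 C2 0 1,
    fromRows (-(C1' * A)) 0, fromRows (-(C1' * B)) 0, by simp, by simp, ?_, ?_, ?_⟩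
  · simp [fromBlocks_multiply, h2]
  · simp [fromBlocks_multiply, h1, e1]
  · simp [act, fromCols_mul_fromBlocks, fromCols_mul_fromRows, h1, e1]


lemma inv_pair {M : Matrix ι ι ℂ} (h : IsUnit M.det) : M * M⁻¹ = 1 ∧ M⁻¹ * M = 1 :=
  ⟨Matrix.mul_nonsing_inv _ h, Matrix.nonsing_inv_mul _ h⟩

lemma Good.base : Good ((fromCols 1 0, 0, 0) : GT ι (ι ⊕ μ)) := by
  have key : ∀ X : GT ι (ι ⊕ μ), IsUnit X.1.toCols₁.det → GF X (fromCols 1 0, 0, 0) := by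
    rintro ⟨C, B, A⟩ hX
    obtain ⟨h1, h2⟩ := inv_pair hX
    have := base_gf C.toCols₁ _ C.toCols₂ B A h1 h2
    rwa [fromCols_toCols] at this
  constructor
  · rintro ⟨C, B, A⟩
    have hc : Continuous fun M : Matrix ι ι ℂ =>
        ((fromCols M C.toCols₂, B, A) : GT ι (ι ⊕ μ)) := by
      refine Continuous.prodMk (continuous_matrix fun i j => ?_) continuous_const
      rcases j with j | j
      · simp only [fromCols_apply_inl]; fun_prop
      · simp only [fromCols_apply_inr]; fun_prop
    have := map_mem_closure (t := {X | GF X (fromCols 1 0, 0, 0)}) hc (dense_units C.toCols₁) ?_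
    · simpa using this
    · intro M hM
      exact key _ (by simpa using hM)
  · have hc : Continuous fun X : GT ι (ι ⊕ μ) => X.1.toCols₁ := by
      refine continuous_matrix fun i j => ?_
      simp only [toCols₁_apply]; fun_prop
    have := hc.continuousAt (x := (fromCols 1 0, 0, 0)) |>.eventually
      (p := fun M => IsUnit M.det) (by simpa using eventually_unit)
    filter_upwards [this] with X hX using key X hX

/-- Intermediate normal form. -/
def NF (Z : Matrix β (α ⊕ β) ℂ × Matrix β (α ⊕ β) ℂ) : GT (α ⊕ β) α :=
  (fromRows 1 0, fromRows 0 Z.1, fromRows 0 Z.2)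

lemma NF_gf (K K' : Matrix α α ℂ) (R R' : Matrix β β ℂ) (W : Matrix α β ℂ)
    (h1 : K * K' = 1) (h2 : K' * K = 1) (h3 : R * R' = 1) (h4 : R' * R = 1)
    (Bl Al : Matrix β (α ⊕ β) ℂ) :
    GF (NF (Bl, Al)) (NF (R' * Bl * fromBlocks K W 0 R, R' * Al * fromBlocks K W 0 R)) := by
  have e1 : ∀ {γ : Type} (M : Matrix α γ ℂ), K * (K' * M) = M := fun M => by
    rw [← Matrix.mul_assoc, h1, Matrix.one_mul]
  have e2 : ∀ {γ : Type} (M : Matrix α γ ℂ), K' * (K * M) = M := fun M => by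
    rw [← Matrix.mul_assoc, h2, Matrix.one_mul]
  refine ⟨fromBlocks K W 0 R, fromBlocks K' (-(K' * W * R')) 0 R', K, K',
    W * R' * (Al * fromBlocks K W 0 R), W * R' * (Bl * fromBlocks K W 0 R), ?_, ?_, h1, h2, ?_⟩
  · simp [fromBlocks_multiply, h1, h3, Matrix.mul_assoc, e1]
  · simp [fromBlocks_multiply, h2, h4, Matrix.mul_assoc]
  · generalize fromBlocks K W 0 R = S
    simp only [act, NF]
    have hadd : ∀ (M : Matrix α (α ⊕ β) ℂ) (N : Matrix β (α ⊕ β) ℂ),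
        fromRows 0 N + fromRows M 0 = fromRows M N := by
      intro M N
      ext (i | i) j <;> simp
    refine Prod.ext ?_ (Prod.ext ?_ ?_) <;>
      simp [fromBlocks_mul_fromRows, fromRows_mul, h2, Matrix.mul_assoc, hadd]

/-- The lower rows after the first reduction. -/
def low (C1 C1' : Matrix α α ℂ) (C2 : Matrix β α ℂ) (B : Matrix (α ⊕ β) (α ⊕ β) ℂ) :
    Matrix β (α ⊕ β) ℂ :=
  fromCols (-(C2 * C1')) (1 : Matrix β β ℂ) * B * fromBlocks C1 0 C2 (1 : Matrix β β ℂ)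

lemma step1_gf (C1 C1' : Matrix α α ℂ) (C2 : Matrix β α ℂ) (B A : Matrix (α ⊕ β) (α ⊕ β) ℂ)
    (h1 : C1 * C1' = 1) (h2 : C1' * C1 = 1) :
    GF ((fromRows C1 C2, B, A) : GT (α ⊕ β) α) (NF (low C1 C1' C2 B, low C1 C1' C2 A)) := by
  have e2 : ∀ {γ : Type} (M : Matrix α γ ℂ), C1' * (C1 * M) = M := fun M => by
    rw [← Matrix.mul_assoc, h2, Matrix.one_mul]
  set S : Matrix (α ⊕ β) (α ⊕ β) ℂ := fromBlocks C1 0 C2 1 with hS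
  have hS' : fromBlocks C1' 0 (-(C2 * C1')) (1 : Matrix β β ℂ) =
      fromRows (fromCols C1' 0) (fromCols (-(C2 * C1')) 1) := by
    rw [fromRows_fromCols_eq_fromBlocks]
  have hC : fromBlocks C1' 0 (-(C2 * C1')) (1 : Matrix β β ℂ) * fromRows C1 C2 = fromRows 1 0 := by
    simp [fromBlocks_mul_fromRows, h2, Matrix.mul_assoc]
  refine ⟨S, fromBlocks C1' 0 (-(C2 * C1')) 1, 1, 1,
    -(fromCols C1' (0 : Matrix α β ℂ) * A * S), -(fromCols C1' (0 : Matrix α β ℂ) * B * S), ?_, ?_, by simp, by simp, ?_⟩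
  · simp [hS, fromBlocks_multiply, h1]
  · simp [hS, fromBlocks_multiply, h2, Matrix.mul_assoc]
  · have hadd : ∀ (M : Matrix α (α ⊕ β) ℂ) (N : Matrix β (α ⊕ β) ℂ),
        fromRows M N + fromRows (-M) 0 = fromRows 0 N := by
      intro M N
      ext (i | i) j <;> simp
    simp only [act, NF, low, ← hS]
    simp only [Matrix.mul_add, ← Matrix.mul_assoc, hC, Matrix.mul_one]
    simp only [hS', fromRows_mul, Matrix.one_mul, Matrix.zero_mul, hadd]

/-- `ℒ` over general index types, lower rows. -/
def LL (T : GT β α) : Matrix β ((α ⊕ β) ⊕ β) ℂ × Matrix β ((α ⊕ β) ⊕ β) ℂ :=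
  (fromCols (fromCols 0 1) 0, fromCols (fromCols T.1 T.2.1) T.2.2)

lemma LL_gf {T T' : GT β α} (h : GF T T') : GF (NF (LL T)) (NF (LL T')) := by
  obtain ⟨S, S', P, P', U, V, h1, h2, h3, h4, rfl⟩ := h
  have e3 : ∀ {γ : Type} (M : Matrix α γ ℂ), P * (P' * M) = M := fun M => by
    rw [← Matrix.mul_assoc, h3, Matrix.one_mul]
  have := NF_gf (fromBlocks P V 0 S) (fromBlocks P' (-(P' * V * S')) 0 S') S S'
    (fromRows U 0) (by simp [fromBlocks_multiply, h1, h3, Matrix.mul_assoc, e3])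
    (by simp [fromBlocks_multiply, h2, h4, Matrix.mul_assoc]) h1 h2 (LL T).1 (LL T).2
  convert this using 2
  simp only [LL, act]
  refine Prod.ext ?_ ?_
  · simp [Matrix.mul_assoc, fromCols_mul_fromBlocks, fromCols_mul_fromRows, mul_fromCols, h2]
  · simp [Matrix.mul_assoc, fromCols_mul_fromBlocks, fromCols_mul_fromRows, mul_fromCols, h2,
      Matrix.mul_add, add_comm]

/-- The transformation matrix of the second reduction. -/
def S2 (B3 : Matrix β α ℂ) (B4' B5 : Matrix β β ℂ) : Matrix ((α ⊕ β) ⊕ β) ((α ⊕ β) ⊕ β) ℂ :=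
  fromBlocks (fromBlocks 1 0 (-(B4' * B3)) B4') (fromRows 0 (-(B4' * B5))) 0 1

/-- Reading off a triple from a row block. -/
def rd (M : Matrix β ((α ⊕ β) ⊕ β) ℂ) : GT β α := (M.toCols₁.toCols₁, M.toCols₁.toCols₂, M.toCols₂)

lemma step2_gf (B3 : Matrix β α ℂ) (B4 B4' B5 : Matrix β β ℂ) (h1 : B4 * B4' = 1)
    (h2 : B4' * B4 = 1) (Al : Matrix β ((α ⊕ β) ⊕ β) ℂ) :
    GF (NF (fromCols (fromCols B3 B4) B5, Al)) (NF (LL (rd (Al * S2 B3 B4' B5)))) := by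
  have e1 : ∀ {γ : Type} (M : Matrix β γ ℂ), B4 * (B4' * M) = M := fun M => by
    rw [← Matrix.mul_assoc, h1, Matrix.one_mul]
  have e2 : ∀ {γ : Type} (M : Matrix β γ ℂ), B4' * (B4 * M) = M := fun M => by
    rw [← Matrix.mul_assoc, h2, Matrix.one_mul]
  have := NF_gf (fromBlocks 1 0 (-(B4' * B3)) B4') (fromBlocks 1 0 B3 B4) 1 1
    (fromRows 0 (-(B4' * B5))) (by simp [fromBlocks_multiply, h2])
    (by simp [fromBlocks_multiply, h1, e1]) (by simp) (by simp)
    (fromCols (fromCols B3 B4) B5) Al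
  convert this using 2
  refine Prod.ext ?_ ?_
  · simp [LL, fromCols_mul_fromBlocks, fromCols_mul_fromRows, h1, e1]
  · simp [LL, rd, S2]

lemma continuous_fromRows {X : Type*} [TopologicalSpace X] {γ δ ε : Type} {f : X → Matrix γ ε ℂ}
    {g : X → Matrix δ ε ℂ} (hf : Continuous f) (hg : Continuous g) :
    Continuous fun x => fromRows (f x) (g x) := by
  refine continuous_matrix fun i j => ?_
  rcases i with i | i
  · exact hf.matrix_elem i j
  · exact hg.matrix_elem i j

lemma continuous_fromCols {X : Type*} [TopologicalSpace X] {γ δ ε : Type} {f : X → Matrix ε γ ℂ}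
    {g : X → Matrix ε δ ℂ} (hf : Continuous f) (hg : Continuous g) :
    Continuous fun x => fromCols (f x) (g x) := by
  refine continuous_matrix fun i j => ?_
  rcases j with j | j
  · exact hf.matrix_elem i j
  · exact hg.matrix_elem i j

lemma continuous_toRows₁ {γ δ ε : Type} :
    Continuous fun M : Matrix (γ ⊕ δ) ε ℂ => M.toRows₁ :=
  continuous_matrix fun i j => continuous_id.matrix_elem (Sum.inl i) j

lemma continuous_toRows₂ {γ δ ε : Type} :
    Continuous fun M : Matrix (γ ⊕ δ) ε ℂ => M.toRows₂ :=
  continuous_matrix fun i j => continuous_id.matrix_elem (Sum.inr i) j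

lemma continuous_toCols₁ {γ δ ε : Type} :
    Continuous fun M : Matrix ε (γ ⊕ δ) ℂ => M.toCols₁ :=
  continuous_matrix fun i j => continuous_id.matrix_elem i (Sum.inl j)

lemma continuous_toCols₂ {γ δ ε : Type} :
    Continuous fun M : Matrix ε (γ ⊕ δ) ℂ => M.toCols₂ :=
  continuous_matrix fun i j => continuous_id.matrix_elem i (Sum.inr j)

lemma continuous_NF : Continuous (NF : _ → GT (α ⊕ β) α) := by
  unfold NF
  exact continuous_const.prodMk ((continuous_fromRows continuous_const continuous_fst).prodMk
    (continuous_fromRows continuous_const continuous_snd))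

lemma continuous_LL : Continuous (LL : GT β α → _) := by
  unfold LL
  exact continuous_const.prodMk (continuous_fromCols (continuous_fromCols (by fun_prop)
    (by fun_prop)) (by fun_prop))

lemma continuous_rd : Continuous (rd : _ → GT β α) := by
  unfold rd
  exact (continuous_toCols₁.comp continuous_toCols₁).prodMk
    ((continuous_toCols₂.comp continuous_toCols₁).prodMk continuous_toCols₂)

lemma step_dense {T : GT β α} (h : Dense {X | GF X T}) :
    Dense {X | GF X (NF (LL T))} := by
  have s1 : ∀ Y : GT β α, NF (LL Y) ∈ closure {X | GF X (NF (LL T))} := fun Y =>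
    map_mem_closure (f := fun Z => NF (LL Z)) (continuous_NF.comp continuous_LL) (h Y)
      fun Z hZ => LL_gf hZ
  have s2 : ∀ (B3 : Matrix β α ℂ) (B4 B5 : Matrix β β ℂ) Al,
      NF (fromCols (fromCols B3 B4) B5, Al) ∈ closure {X | GF X (NF (LL T))} := by
    intro B3 B4 B5 Al
    have hc : Continuous fun M : Matrix β β ℂ => NF (fromCols (fromCols B3 M) B5, Al) :=
      continuous_NF.comp ((continuous_fromCols (continuous_fromCols continuous_const
        continuous_id) continuous_const).prodMk continuous_const)
    rw [← closure_closure]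
    refine map_mem_closure (f := fun M : Matrix β β ℂ => NF (fromCols (fromCols B3 M) B5, Al))
      hc (dense_units B4) fun M hM => ?_
    obtain ⟨h1, h2⟩ := inv_pair hM
    exact closure_sat (step2_gf B3 M _ B5 h1 h2 Al).symm (s1 _)
  have s3 : ∀ Z, NF Z ∈ closure {X | GF X (NF (LL T))} := by
    rintro ⟨Bl, Al⟩
    simpa using s2 Bl.toCols₁.toCols₁ Bl.toCols₁.toCols₂ Bl.toCols₂ Al
  rintro ⟨C, B, A⟩
  have hc : Continuous fun M : Matrix (α ⊕ β) (α ⊕ β) ℂ =>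
      ((fromRows M C.toRows₂, B, A) : GT ((α ⊕ β) ⊕ β) (α ⊕ β)) :=
    (continuous_fromRows continuous_id continuous_const).prodMk continuous_const
  have := map_mem_closure (t := closure {X | GF X (NF (LL T))}) hc (dense_units C.toRows₁) ?_
  · simpa using this
  · intro M hM
    obtain ⟨h1, h2⟩ := inv_pair hM
    exact closure_sat (step1_gf M _ C.toRows₂ B A h1 h2).symm (s3 _)

lemma step_open1 {T : GT β α} (h : ∀ᶠ X in 𝓝 T, GF X T) :
    ∀ᶠ Z in 𝓝 (LL T), GF (NF Z) (NF (LL T)) := by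
  let ρ : Matrix β ((α ⊕ β) ⊕ β) ℂ × Matrix β ((α ⊕ β) ⊕ β) ℂ → GT β α := fun Z =>
    rd (Z.2 * S2 Z.1.toCols₁.toCols₁ Z.1.toCols₁.toCols₂⁻¹ Z.1.toCols₂)
  have hρ : ρ (LL T) = T := by
    simp [ρ, LL, S2, rd, fromCols_mul_fromBlocks]
  have c1 : Continuous fun Z : Matrix β ((α ⊕ β) ⊕ β) ℂ × Matrix β ((α ⊕ β) ⊕ β) ℂ =>
      Z.1.toCols₁.toCols₂ :=
    continuous_toCols₂.comp (continuous_toCols₁.comp continuous_fst)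
  have c2 : ContinuousAt (fun Z : Matrix β ((α ⊕ β) ⊕ β) ℂ × Matrix β ((α ⊕ β) ⊕ β) ℂ =>
      Z.1.toCols₁.toCols₂⁻¹) (LL T) := by
    refine ContinuousAt.comp (g := Inv.inv) ?_ c1.continuousAt
    simpa [LL] using contAt_inv_one
  have c3 : Continuous fun p : (Matrix β ((α ⊕ β) ⊕ β) ℂ × Matrix β ((α ⊕ β) ⊕ β) ℂ) ×
      Matrix β β ℂ => rd (p.1.2 * S2 p.1.1.toCols₁.toCols₁ p.2 p.1.1.toCols₂) := by
    have k1 : Continuous fun p : (Matrix β ((α ⊕ β) ⊕ β) ℂ × Matrix β ((α ⊕ β) ⊕ β) ℂ) ×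
      Matrix β β ℂ => p.1.1.toCols₁.toCols₁ :=
      continuous_toCols₁.comp (continuous_toCols₁.comp (by fun_prop))
    have k2 : Continuous fun p : (Matrix β ((α ⊕ β) ⊕ β) ℂ × Matrix β ((α ⊕ β) ⊕ β) ℂ) ×
      Matrix β β ℂ => p.1.1.toCols₂ :=
      continuous_toCols₂.comp (by fun_prop)
    unfold S2
    refine continuous_rd.comp (Continuous.matrix_mul (by fun_prop) ?_)
    refine Continuous.matrix_fromBlocks ?_ ?_ continuous_const continuous_const
    · fun_prop
    · exact continuous_fromRows continuous_const (by fun_prop)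
  have c4 : ContinuousAt ρ (LL T) :=
    ContinuousAt.comp (x := LL T)
      (f := fun Z : Matrix β ((α ⊕ β) ⊕ β) ℂ × Matrix β ((α ⊕ β) ⊕ β) ℂ =>
        (Z, Z.1.toCols₁.toCols₂⁻¹))
      c3.continuousAt (continuousAt_id.prodMk c2)
  have e1 : ∀ᶠ Z in 𝓝 (LL T), GF (ρ Z) T := c4.eventually (by rwa [hρ])
  have e2 : ∀ᶠ Z in 𝓝 (LL T), IsUnit (Z.1.toCols₁.toCols₂).det :=
    c1.continuousAt.eventually (p := fun M => IsUnit M.det) (by simpa [LL] using eventually_unit)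
  filter_upwards [e1, e2] with Z h1 h2
  obtain ⟨k1, k2⟩ := inv_pair h2
  have := step2_gf Z.1.toCols₁.toCols₁ _ _ Z.1.toCols₂ k1 k2 Z.2
  rw [fromCols_toCols, fromCols_toCols] at this
  exact this.trans (LL_gf h1)

lemma step_open2 {Z : Matrix β (α ⊕ β) ℂ × Matrix β (α ⊕ β) ℂ}
    (h : ∀ᶠ W in 𝓝 Z, GF (NF W) (NF Z)) :
    ∀ᶠ X in 𝓝 (NF Z), GF X (NF Z) := by
  let ρ : GT (α ⊕ β) α → Matrix β (α ⊕ β) ℂ × Matrix β (α ⊕ β) ℂ := fun X =>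
    (low X.1.toRows₁ X.1.toRows₁⁻¹ X.1.toRows₂ X.2.1,
      low X.1.toRows₁ X.1.toRows₁⁻¹ X.1.toRows₂ X.2.2)
  have hρ : ρ (NF Z) = Z := by
    simp [ρ, NF, low, fromCols_mul_fromRows]
  have c1 : Continuous fun X : GT (α ⊕ β) α => X.1.toRows₁ := continuous_toRows₁.comp continuous_fst
  have c1' : Continuous fun X : GT (α ⊕ β) α => X.1.toRows₂ :=
    continuous_toRows₂.comp continuous_fst
  have c2 : ContinuousAt (fun X : GT (α ⊕ β) α => X.1.toRows₁⁻¹) (NF Z) := by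
    refine ContinuousAt.comp (g := Inv.inv) ?_ c1.continuousAt
    simpa [NF] using contAt_inv_one
  have c3 : Continuous fun p : (GT (α ⊕ β) α) × Matrix α α ℂ =>
      (low p.1.1.toRows₁ p.2 p.1.1.toRows₂ p.1.2.1,
       low p.1.1.toRows₁ p.2 p.1.1.toRows₂ p.1.2.2) := by
    have k1 : Continuous fun p : (GT (α ⊕ β) α) × Matrix α α ℂ => p.1.1.toRows₁ :=
      c1.comp continuous_fst
    have k2 : Continuous fun p : (GT (α ⊕ β) α) × Matrix α α ℂ => p.1.1.toRows₂ :=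
      c1'.comp continuous_fst
    have k3 : Continuous fun p : (GT (α ⊕ β) α) × Matrix α α ℂ =>
      fromCols (-(p.1.1.toRows₂ * p.2)) (1 : Matrix β β ℂ) :=
      continuous_fromCols (by fun_prop) continuous_const
    unfold low
    fun_prop
  have c4 : ContinuousAt ρ (NF Z) :=
    ContinuousAt.comp (x := NF Z) (f := fun X : GT (α ⊕ β) α => (X, X.1.toRows₁⁻¹))
      c3.continuousAt (continuousAt_id.prodMk c2)
  have e1 : ∀ᶠ X in 𝓝 (NF Z), GF (NF (ρ X)) (NF Z) := c4.eventually (p := fun W =>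
    GF (NF W) (NF Z)) (by rwa [hρ])
  have e2 : ∀ᶠ X in 𝓝 (NF Z), IsUnit (X.1.toRows₁).det :=
    c1.continuousAt.eventually (p := fun M => IsUnit M.det) (by simpa [NF] using eventually_unit)
  filter_upwards [e1, e2] with X h1 h2
  obtain ⟨k1, k2⟩ := inv_pair h2
  have := step1_gf X.1.toRows₁ _ X.1.toRows₂ X.2.1 X.2.2 k1 k2
  rw [fromRows_toRows] at this
  exact this.trans h1

lemma Good.step {T : GT β α} (h : Good T) : Good (NF (LL T)) :=
  ⟨step_dense h.1, step_open2 (step_open1 h.2)⟩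

end gen

lemma FST_iff {m n : ℕ} (X Y : TripleT m n) : FST X Y ↔ GF X Y := by
  constructor
  · rintro ⟨S, P, U, V, hS, hP, h1, h2, h3⟩
    obtain ⟨s1, s2⟩ := inv_pair ((Matrix.isUnit_iff_isUnit_det _).1 hS)
    obtain ⟨p1, p2⟩ := inv_pair ((Matrix.isUnit_iff_isUnit_det _).1 hP)
    exact ⟨S, S⁻¹, P, P⁻¹, U, V, s1, s2, p1, p2, Prod.ext h1 (Prod.ext h2 h3)⟩
  · rintro ⟨S, S', P, P', U, V, h1, h2, h3, h4, rfl⟩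
    have hS : S⁻¹ = S' := Matrix.inv_eq_right_inv h1
    refine ⟨S, P, U, V, ⟨⟨S, S', h1, h2⟩, rfl⟩, ⟨⟨P, P', h3, h4⟩, rfl⟩, ?_, ?_, ?_⟩ <;>
      rw [hS] <;> rfl

/-- Row index equivalence for `ℒ`. -/
def eRow (p q : ℕ) : (Fin q ⊕ Fin p) ⊕ Fin p ≃ Fin (2 * p + q) :=
  ((Equiv.sumCongr finSumFinEquiv (Equiv.refl (Fin p))).trans finSumFinEquiv).trans
    (finCongr (by omega))

/-- Column index equivalence for `ℒ`. -/
def eCol (p q : ℕ) : Fin q ⊕ Fin p ≃ Fin (p + q) :=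
  finSumFinEquiv.trans (finCongr (by omega))

lemma Ltriple_eq {p q : ℕ} (T : TripleT p q) :
    Ltriple T = rei (eRow p q) (eCol p q) (NF (LL T)) := by
  refine Prod.ext ?_ (Prod.ext ?_ ?_)
  · ext i j
    obtain ⟨i, rfl⟩ := (eRow p q).surjective i
    obtain ⟨j, rfl⟩ := (eCol p q).surjective j
    rcases i with (i | i) | i <;> rcases j with j | j <;>
      simp [Ltriple, rei, NF, eRow, eCol, Matrix.one_apply, Fin.ext_iff] <;> grind
  · ext i j
    obtain ⟨i, rfl⟩ := (eRow p q).surjective i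
    obtain ⟨j, rfl⟩ := (eRow p q).surjective j
    rcases i with (i | i) | i <;> rcases j with (j | j) | j <;>
      simp [Ltriple, rei, NF, LL, eRow, Matrix.one_apply, Fin.ext_iff] <;> grind
  · ext i j
    obtain ⟨i, rfl⟩ := (eRow p q).surjective i
    obtain ⟨j, rfl⟩ := (eRow p q).surjective j
    rcases i with (i | i) | i <;> rcases j with (j | j) | j <;>
      simp [Ltriple, rei, NF, LL, eRow] <;> grind

lemma Good.Ltriple {p q : ℕ} {T : TripleT p q} (h : Good T) : Good (Ltriple T) := by
  rw [Ltriple_eq]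
  exact h.step.rei _ _

lemma Good.Fmat {p q : ℕ} (h : p ≤ q) : Good ((Fmat p q, 0, 0) : TripleT p q) := by
  obtain ⟨r, rfl⟩ := Nat.exists_eq_add_of_le h
  have : ((_root_.Fmat p (p + r), 0, 0) : TripleT p (p + r)) =
      FeedbackAux.rei (Equiv.refl _) finSumFinEquiv (fromCols 1 0, 0, 0) := by
    refine Prod.ext ?_ (Prod.ext ?_ ?_)
    · ext i j
      obtain ⟨j, rfl⟩ := finSumFinEquiv.surjective j
      rcases j with j | j <;> simp [_root_.Fmat, FeedbackAux.rei, Matrix.one_apply, Fin.ext_iff]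
      all_goals grind
    · simp [FeedbackAux.rei]
    · simp [FeedbackAux.rei]
  rw [this]
  exact Good.base.rei _ _

/-- The starting triple `(F_{pq}, 0, 0)`. -/
def st (p q : ℕ) : TripleS := ⟨p, q, (Fmat p q, 0, 0)⟩

lemma good_iter (l p q : ℕ) (h : p ≤ q) :
    Good (Lop^[l] (st p q)).2.2 := by
  induction l with
  | zero => exact Good.Fmat h
  | succ l ih =>
    rw [Function.iterate_succ_apply']
    exact Good.Ltriple ih

lemma good_of_isLform {m n : ℕ} {T : TripleT m n} (h : IsLform m n T) : Good T := by
  obtain ⟨l, p, q, hpq, h⟩ := h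
  have := good_iter l p q hpq
  change Lop^[l] (st p q) = _ at h
  rw [h] at this
  exact this

lemma base_unique (k p q p' q' : ℕ) (h : p ≤ q)
    (h1 : p = (Lop^[k] (st p' q')).1)
    (h2 : q = (Lop^[k] (st p' q')).2.1) :
    st p q = Lop^[k] (st p' q') := by
  cases k with
  | zero =>
    simp only [Function.iterate_zero, id] at h1 h2 ⊢
    simp only [st] at h1 h2
    subst h1 h2; rfl
  | succ k =>
    rw [Function.iterate_succ_apply'] at h1 h2 ⊢
    generalize Lop^[k] (st p' q') = y at h1 h2 ⊢
    obtain ⟨a, b, T⟩ := y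
    simp only [Lop] at h1 h2
    subst h1 h2
    have ha : a = 0 := by omega
    subst ha
    simp only [Lop, st]
    congr 2
    refine Prod.ext ?_ (Prod.ext ?_ ?_)
    · rfl
    · ext i j
      have := i.isLt
      simp [Ltriple]
      omega
    · ext i j
      have := i.isLt
      simp [Ltriple]
      omega

lemma iter_unique (k l p q p' q' : ℕ) (h : p ≤ q) (h' : p' ≤ q')
    (h1 : (Lop^[l] (st p q)).1 = (Lop^[k] (st p' q')).1)
    (h2 : (Lop^[l] (st p q)).2.1 = (Lop^[k] (st p' q')).2.1) :
    Lop^[l] (st p q) = Lop^[k] (st p' q') := by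
  induction l generalizing k with
  | zero => exact base_unique k p q p' q' h h1 h2
  | succ l ih =>
    cases k with
    | zero => exact (base_unique (l + 1) p' q' p q h' h1.symm h2.symm).symm
    | succ k =>
      rw [Function.iterate_succ_apply', Function.iterate_succ_apply' Lop k] at h1 h2 ⊢
      simp only [Lop] at h1 h2
      rw [ih k (by omega) (by omega)]

lemma lform_unique {m n : ℕ} {T T' : TripleT m n} (h : IsLform m n T) (h' : IsLform m n T') :
    T = T' := by
  obtain ⟨l, p, q, hpq, h⟩ := h
  obtain ⟨l', p', q', hpq', h'⟩ := h'
  change Lop^[l] (st p q) = _ at h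
  change Lop^[l'] (st p' q') = _ at h'
  have := iter_unique l' l p q p' q' hpq hpq' (by rw [h, h']) (by rw [h, h'])
  rw [h, h'] at this
  have := (Sigma.mk.inj_iff.1 this).2
  have := (Sigma.mk.inj_iff.1 (eq_of_heq this)).2
  exact eq_of_heq this

lemma lform_exists (m : ℕ) : ∀ n : ℕ, 0 < n → (m : ℝ) < (n : ℝ) * (1 + Real.sqrt 5) / 2 →
    ∃ T : TripleT m n, IsLform m n T := by
  induction m using Nat.strong_induction_on with
  | _ m ih =>
    intro n hn h
    by_cases hmn : m ≤ n
    · exact ⟨_, 0, m, n, hmn, rfl⟩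
    have hs : Real.sqrt 5 ^ 2 = 5 := Real.sq_sqrt (by norm_num)
    have hs0 := Real.sqrt_nonneg 5
    have hs3 : Real.sqrt 5 < 3 := by nlinarith
    have hs1 : 1 < Real.sqrt 5 := by nlinarith
    have hn' : (0 : ℝ) < n := by exact_mod_cast hn
    have h2n : m < 2 * n := by
      have : (m : ℝ) < 2 * n := by nlinarith
      exact_mod_cast this
    obtain ⟨p, hp⟩ := Nat.exists_eq_add_of_le (le_of_not_ge hmn)
    obtain ⟨q, hq⟩ := Nat.exists_eq_add_of_le (show p ≤ n by omega)
    obtain rfl : m = 2 * p + q := by omega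
    obtain rfl : n = p + q := by omega
    obtain ⟨T, l, a, b, hab, hT⟩ := ih p (by omega) q (by omega) (by
      push_cast at h
      nlinarith)
    refine ⟨Ltriple T, l + 1, a, b, hab, ?_⟩
    change Lop^[l] (st a b) = _ at hT
    change Lop^[l + 1] (st a b) = _
    rw [Function.iterate_succ_apply', hT]
    rfl

lemma continuous_fnorm {p q : ℕ} : Continuous (fnorm : Matrix (Fin p) (Fin q) ℂ → ℝ) := by
  unfold fnorm
  refine Real.continuous_sqrt.comp ?_
  refine continuous_finsetSum _ fun i _ => continuous_finsetSum _ fun j _ => ?_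
  exact (continuous_norm.comp (continuous_id.matrix_elem i j)).pow 2

lemma continuous_tnorm {m n : ℕ} : Continuous (tnorm : TripleT m n → ℝ) := by
  unfold tnorm
  exact ((continuous_fnorm.comp continuous_fst).add
    (continuous_fnorm.comp (continuous_fst.comp continuous_snd))).add
    (continuous_fnorm.comp (continuous_snd.comp continuous_snd))

lemma tnorm_zero {m n : ℕ} : tnorm (0 : TripleT m n) = 0 := by
  simp [tnorm, fnorm]

lemma tnorm_ball {m n : ℕ} (X : TripleT m n) {ε : ℝ} (h : 0 < ε) :
    ∀ᶠ Y in 𝓝 X, tnorm (Y - X) < ε := by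
  have hc : Continuous fun Y : TripleT m n => tnorm (Y - X) :=
    continuous_tnorm.comp (continuous_id.sub continuous_const)
  exact hc.continuousAt.eventually_lt_const (by simpa [tnorm_zero] using h)

lemma fnorm_nonneg {p q : ℕ} (M : Matrix (Fin p) (Fin q) ℂ) : 0 ≤ fnorm M := Real.sqrt_nonneg _

lemma le_fnorm {p q : ℕ} (M : Matrix (Fin p) (Fin q) ℂ) (i j) : ‖M i j‖ ≤ fnorm M := by
  unfold fnorm
  apply Real.le_sqrt_of_sq_le
  calc ‖M i j‖ ^ 2 ≤ ∑ j, ‖M i j‖ ^ 2 :=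
        Finset.single_le_sum (f := fun j => ‖M i j‖ ^ 2) (fun _ _ => by positivity)
          (Finset.mem_univ j)
    _ ≤ _ := Finset.single_le_sum (f := fun i => ∑ j, ‖M i j‖ ^ 2) (fun _ _ => by positivity)
          (Finset.mem_univ i)

lemma tendsto_of_fnorm {p q : ℕ} {γ : Type*} {F : Filter γ} {f : γ → Matrix (Fin p) (Fin q) ℂ}
    {M : Matrix (Fin p) (Fin q) ℂ} (h : Tendsto (fun x => fnorm (f x - M)) F (𝓝 0)) :
    Tendsto f F (𝓝 M) := by
  refine tendsto_pi_nhds.2 fun i => tendsto_pi_nhds.2 fun j => ?_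
  rw [tendsto_iff_norm_sub_tendsto_zero]
  exact squeeze_zero (fun _ => norm_nonneg _) (fun x => le_fnorm (f x - M) i j) h

lemma ball_of_eventually {m n : ℕ} (X : TripleT m n) {p : TripleT m n → Prop}
    (h : ∀ᶠ Y in 𝓝 X, p Y) : ∃ ε : ℝ, 0 < ε ∧ ∀ Y, tnorm (Y - X) < ε → p Y := by
  let F : Filter (TripleT m n) := comap (fun Y => tnorm (Y - X)) (𝓝 0)
  have hF : Tendsto (fun Y : TripleT m n => tnorm (Y - X)) F (𝓝 0) := tendsto_comap
  have hT : Tendsto id F (𝓝 X) := by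
    have hle : ∀ Y : TripleT m n, fnorm (Y.1 - X.1) ≤ tnorm (Y - X) ∧
        fnorm (Y.2.1 - X.2.1) ≤ tnorm (Y - X) ∧ fnorm (Y.2.2 - X.2.2) ≤ tnorm (Y - X) := by
      intro Y
      have h1 := fnorm_nonneg (Y.1 - X.1)
      have h2 := fnorm_nonneg (Y.2.1 - X.2.1)
      have h3 := fnorm_nonneg (Y.2.2 - X.2.2)
      simp only [tnorm, Prod.fst_sub, Prod.snd_sub]
      refine ⟨?_, ?_, ?_⟩ <;> linarith
    have t1 : Tendsto (fun Y : TripleT m n => Y.1) F (𝓝 X.1) := tendsto_of_fnorm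
      (squeeze_zero (fun _ => fnorm_nonneg _) (fun Y => (hle Y).1) hF)
    have t2 : Tendsto (fun Y : TripleT m n => Y.2.1) F (𝓝 X.2.1) := tendsto_of_fnorm
      (squeeze_zero (fun _ => fnorm_nonneg _) (fun Y => (hle Y).2.1) hF)
    have t3 : Tendsto (fun Y : TripleT m n => Y.2.2) F (𝓝 X.2.2) := tendsto_of_fnorm
      (squeeze_zero (fun _ => fnorm_nonneg _) (fun Y => (hle Y).2.2) hF)
    exact t1.prodMk_nhds (t2.prodMk_nhds t3)
  have hp : ∀ᶠ Y in F, p Y := hT.eventually h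
  rw [eventually_comap] at hp
  obtain ⟨ε, hε, H⟩ := Metric.eventually_nhds_iff.1 hp
  refine ⟨ε, hε, fun Y hY => H ?_ Y rfl⟩
  have : 0 ≤ tnorm (Y - X) :=
    add_nonneg (add_nonneg (fnorm_nonneg _) (fnorm_nonneg _)) (fnorm_nonneg _)
  rwa [Real.dist_eq, sub_zero, abs_of_nonneg this]

end FeedbackAux

/-- Theorem 11(a) of the paper: for `m < n(1+√5)/2` there is exactly
one `m×(n,m,m)` triple of the form `ℒ^{(l)}(F_{pq}, 0, 0)`; the set of triples feedback
similar to it is open, everywhere dense, and coincides with the set of rigid triples. -/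
theorem stmt11 (m n : ℕ) (hm : 0 < m) (hn : 0 < n)
    (h : (m:ℝ) < (n:ℝ) * (1 + Real.sqrt 5) / 2) :
    (∃! T : TripleT m n, IsLform m n T) ∧
    ∀ T : TripleT m n, IsLform m n T →
      ((∀ X : TripleT m n, FST X T →
          ∃ ε : ℝ, 0 < ε ∧ ∀ Y : TripleT m n, tnorm (Y - X) < ε → FST Y T) ∧
       (∀ X : TripleT m n, ∀ ε : ℝ, 0 < ε →
          ∃ Y : TripleT m n, FST Y T ∧ tnorm (Y - X) < ε) ∧
       (∀ X : TripleT m n, FST X T ↔ RigidT X)) := by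
  refine ⟨?_, fun T hT => ?_⟩
  · obtain ⟨T, hT⟩ := FeedbackAux.lform_exists m n hn h
    exact ⟨T, hT, fun T' hT' => FeedbackAux.lform_unique hT' hT⟩
  have hg := FeedbackAux.good_of_isLform hT
  have hopen : ∀ X : TripleT m n, FST X T →
      ∃ ε : ℝ, 0 < ε ∧ ∀ Y : TripleT m n, tnorm (Y - X) < ε → FST Y T := by
    intro X hX
    rw [FeedbackAux.FST_iff] at hX
    simp only [FeedbackAux.FST_iff]
    exact FeedbackAux.ball_of_eventually X (FeedbackAux.nhds_sat hX hg.2)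
  have hdense : ∀ X : TripleT m n, ∀ ε : ℝ, 0 < ε →
      ∃ Y : TripleT m n, FST Y T ∧ tnorm (Y - X) < ε := by
    intro X ε hε
    obtain ⟨Y, hY1, hY2⟩ := mem_closure_iff_nhds.1 (hg.1 X) _ (FeedbackAux.tnorm_ball X hε)
    exact ⟨Y, (FeedbackAux.FST_iff _ _).2 hY2, hY1⟩
  refine ⟨hopen, hdense, fun X => ⟨fun hX => ?_, ?_⟩⟩
  · obtain ⟨ε, hε, H⟩ := hopen X hX
    refine ⟨ε, hε, fun Y hY => ?_⟩
    have h1 := H Y hY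
    rw [FeedbackAux.FST_iff] at h1 hX ⊢
    exact h1.trans hX.symm
  · rintro ⟨ε, hε, H⟩
    obtain ⟨Y, hY1, hY2⟩ := hdense X ε hε
    have h1 := H Y hY2
    rw [FeedbackAux.FST_iff] at h1 hY1 ⊢
    exact h1.symm.trans hY1
end
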